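/- Let ell >= 1 and r be integers, and let q be real with 0 < q < 1. For each integer k >= max(ell,1) define S_k(q) = sum q^{(r - n_0)(r + n_0 + 2ell)/(4k) + C(n_0+1,2) + n C^{-1}(n - n_0 e_1 - e_ell)} / ((q;q)_{n_0} (q;q)_{n_1} ... (q;q)_{n_{k-1}}), where the sum is over integers n_0, ..., n_{k-1} >= 0 satisfying n_0 - r == 2*sum_{i=1}^{k-1} i n_i (mod 2k) (equivalently (n_0 - r)/(2k) + (C^{-1}n)_1 is an integer), with n = (n_1,...,n_{k-1}). Then lim_{k -> infinity} S_k(q) = V_r(q) - V_{r+2ell+1}(q). -/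

import Mathlib

open scoped BigOperators

noncomputable section

/-- Finite q-Pochhammer symbol `(a;q)_n`. -/
def qP (q a : ℝ) (n : ℕ) : ℝ := ∏ m ∈ Finset.range n, (1 - a * q ^ m)

/-- Infinite q-Pochhammer symbol `(a;q)_∞`. -/
def qPInf (q a : ℝ) : ℝ := ∏' m : ℕ, (1 - a * q ^ m)

/-- `C(n,2) = n(n-1)/2` for `n : ℤ` (exact integer division). -/
def ch2 (n : ℤ) : ℤ := n * (n - 1) / 2

/-- Graded parafermion Verma character `V_t(q)`. -/
def V (q : ℝ) (t : ℤ) : ℝ :=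
  (qPInf q q)⁻¹ * ∑' ij : ℕ × ℕ,
    q ^ (((ch2 (2 * (ij.2 : ℤ) - 2 * (ij.1 : ℤ) - t) + (ij.2 : ℤ) : ℤ) : ℝ)) *
      ((qP q q ij.1)⁻¹ * (qP q q ij.2)⁻¹)

/-- Entry `(C⁻¹)_{i+1,j+1}` of the inverse A_{k-1} Cartan matrix (0-based indices). -/
def cinv (k i j : ℕ) : ℚ :=
  (min (i + 1) (j + 1) : ℚ) - (((i : ℚ) + 1) * ((j : ℚ) + 1)) / (k : ℚ)

/-- Quadratic form `w C⁻¹ v`. -/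
def quad (k : ℕ) (w v : Fin (k - 1) → ℤ) : ℚ :=
  ∑ i : Fin (k - 1), ∑ j : Fin (k - 1), (w i : ℚ) * cinv k (i : ℕ) (j : ℕ) * (v j : ℚ)

/-- The unit vector `e_l` of `ℤ^{k-1}` (1-based label; `e_0 = e_k = 0`). -/
def eV (k : ℕ) (l : ℤ) : Fin (k - 1) → ℤ := fun i => if (i : ℤ) + 1 = l then 1 else 0

noncomputable section
open Finset

lemma qP_zero (q a : ℝ) : qP q a 0 = 1 := by simp [qP]
lemma qP_succ (q a : ℝ) (n : ℕ) : qP q a (n+1) = qP q a n * (1 - a * q^n) := by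
  simp [qP, Finset.prod_range_succ]
lemma qq_succ (q : ℝ) (n : ℕ) : qP q q (n+1) = qP q q n * (1 - q^(n+1)) := by
  rw [qP_succ, pow_succ']

lemma qq_pos {q : ℝ} (h0 : 0 < q) (h1 : q < 1) (n : ℕ) : 0 < qP q q n := by
  unfold qP
  refine Finset.prod_pos fun m _ => ?_
  have : q * q^m < 1 := by
    rw [← pow_succ']; exact pow_lt_one₀ h0.le h1 (by simp)
  linarith

lemma qq_ne {q : ℝ} (h0 : 0 < q) (h1 : q < 1) (n : ℕ) : qP q q n ≠ 0 := (qq_pos h0 h1 n).ne'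

lemma one_sub_ne {q : ℝ} (h0 : 0 < q) (h1 : q < 1) (n : ℕ) : 1 - q^(n+1) ≠ 0 := by
  have := pow_lt_one₀ h0.le h1 (n := n+1) (by simp)
  exact (sub_pos.2 this).ne'

lemma summ_qq {q : ℝ} (h0 : 0 < q) (h1 : q < 1) : Summable (fun m : ℕ => ‖-(q * q^m)‖) := by
  simp only [norm_neg, norm_mul, norm_pow, Real.norm_eq_abs, abs_of_pos h0]
  exact (summable_geometric_of_lt_one h0.le h1).mul_left q

lemma qInf_ne {q : ℝ} (h0 : 0 < q) (h1 : q < 1) : qPInf q q ≠ 0 := by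
  unfold qPInf
  have := tprod_one_add_ne_zero_of_summable (R := ℝ) (f := fun m : ℕ => -(q * q^m)) (fun m => by
    have := one_sub_ne h0 h1 m
    rw [pow_succ'] at this; simpa [sub_eq_add_neg] using this) (summ_qq h0 h1)
  simpa [sub_eq_add_neg] using this

lemma qq_tendsto {q : ℝ} (h0 : 0 < q) (h1 : q < 1) :
    Filter.Tendsto (fun n => qP q q n) Filter.atTop (nhds (qPInf q q)) := by
  have h : Multipliable (fun m : ℕ => 1 + -(q * q^m)) :=
    multipliable_one_add_of_summable (summ_qq h0 h1)
  have := h.tendsto_prod_tprod_nat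
  simpa [qP, qPInf, sub_eq_add_neg] using this

lemma qInf_pos {q : ℝ} (h0 : 0 < q) (h1 : q < 1) : 0 < qPInf q q :=
  lt_of_le_of_ne (ge_of_tendsto' (qq_tendsto h0 h1) fun n => (qq_pos h0 h1 n).le)
    (qInf_ne h0 h1).symm

lemma qq_anti {q : ℝ} (h0 : 0 < q) (h1 : q < 1) : Antitone (fun n => qP q q n) := by
  refine antitone_nat_of_succ_le fun n => ?_
  rw [qq_succ]
  have := qq_pos h0 h1 n
  have h2 : 0 < q^(n+1) := by positivity
  nlinarith

lemma qInf_le {q : ℝ} (h0 : 0 < q) (h1 : q < 1) (n : ℕ) : qPInf q q ≤ qP q q n :=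
  (qq_anti h0 h1).le_of_tendsto (qq_tendsto h0 h1) n

lemma qq_inv_le {q : ℝ} (h0 : 0 < q) (h1 : q < 1) (n : ℕ) : (qP q q n)⁻¹ ≤ (qPInf q q)⁻¹ :=
  inv_anti₀ (qInf_pos h0 h1) (qInf_le h0 h1 n)

/-- Gaussian binomial -/
def gb (q : ℝ) (n s : ℕ) : ℝ := if s ≤ n then qP q q n / (qP q q s * qP q q (n - s)) else 0

lemma gb_zero {q : ℝ} (h0 : 0 < q) (h1 : q < 1) (n : ℕ) : gb q n 0 = 1 := by
  simp [gb, qP_zero, div_self (qq_ne h0 h1 n)]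

lemma gb_gt {q : ℝ} {n s : ℕ} (h : n < s) : gb q n s = 0 := by
  simp [gb, h]

lemma gb_self {q : ℝ} (h0 : 0 < q) (h1 : q < 1) (n : ℕ) : gb q n n = 1 := by
  simp [gb, qP_zero, div_self (qq_ne h0 h1 n)]

lemma gb_succ {q : ℝ} (h0 : 0 < q) (h1 : q < 1) {n s : ℕ} (h : s ≤ n) :
    gb q (n+1) (s+1) = gb q n (s+1) + q^(n-s) * gb q n s := by
  obtain ⟨t, rfl⟩ := Nat.exists_eq_add_of_le h
  have hA := qq_ne h0 h1
  have hB := one_sub_ne h0 h1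
  rcases t with _ | t
  · simp only [add_zero, Nat.sub_self]
    rw [gb_gt (Nat.lt_succ_self s), gb_self h0 h1, gb_self h0 h1]; simp
  · have e1 : s + (t+1) + 1 - (s+1) = t+1 := by omega
    have e2 : s + (t+1) - (s+1) = t := by omega
    have e3 : s + (t+1) - s = t+1 := by omega
    unfold gb
    rw [if_pos (by omega), if_pos (by omega), if_pos (by omega), e1, e2, e3]
    rw [qq_succ q (s + (t+1)), qq_succ q s, qq_succ q t]
    have := hA s; have := hA t; have := hB s; have := hB t
    field_simp
    ring

lemma gb_nonneg {q : ℝ} (h0 : 0 < q) (h1 : q < 1) (n s : ℕ) : 0 ≤ gb q n s := by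
  unfold gb
  split_ifs
  · have := qq_pos h0 h1
    exact div_nonneg (this _).le (mul_nonneg (this _).le (this _).le)
  · rfl

lemma gb_absorb {q : ℝ} (h0 : 0 < q) (h1 : q < 1) (n s : ℕ) :
    gb q (n+1) (s+1) * (1 - q^(s+1)) = (1 - q^(n+1)) * gb q n s := by
  unfold gb
  by_cases h : s ≤ n
  · rw [if_pos (by omega), if_pos h, Nat.add_sub_add_right, qq_succ, qq_succ]
    have := qq_ne h0 h1 s; have := qq_ne h0 h1 (n-s); have := one_sub_ne h0 h1 s
    field_simp
  · rw [if_neg (by omega), if_neg h]; simp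

lemma gb_tendsto {q : ℝ} (h0 : 0 < q) (h1 : q < 1) (s : ℕ) :
    Filter.Tendsto (fun n => gb q n s) Filter.atTop (nhds (qP q q s)⁻¹) := by
  have h := qq_tendsto h0 h1
  have h2 : Filter.Tendsto (fun n => qP q q n / (qP q q s * qP q q (n - s))) Filter.atTop
      (nhds (qPInf q q / (qP q q s * qPInf q q))) := by
    refine h.div (tendsto_const_nhds.mul (h.comp (Filter.tendsto_sub_atTop_nat s))) ?_
    exact mul_ne_zero (qq_ne h0 h1 s) (qInf_ne h0 h1)
  have e : qPInf q q / (qP q q s * qPInf q q) = (qP q q s)⁻¹ := by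
    have := qInf_ne h0 h1; have := qq_ne h0 h1 s
    field_simp
  rw [e] at h2
  refine h2.congr' ?_
  filter_upwards [Filter.eventually_ge_atTop s] with n hn
  simp [gb, hn]

lemma gb_le {q : ℝ} (h0 : 0 < q) (h1 : q < 1) (n s : ℕ) : gb q n s ≤ (qP q q s)⁻¹ := by
  have hp := qq_pos h0 h1
  unfold gb
  split_ifs with h
  · rw [div_le_iff₀ (mul_pos (hp _) (hp _)), inv_mul_cancel_left₀ (hp s).ne']
    exact qq_anti h0 h1 (Nat.sub_le n s)
  · exact (inv_pos.2 (hp s)).le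

section generic
variable {R : Type*} [CommRing R]

def rP (Q a : R) (n : ℕ) : R := ∏ m ∈ Finset.range n, (1 - a * Q ^ m)

lemma rP_zero (Q a : R) : rP Q a 0 = 1 := by simp [rP]
lemma rP_succ (Q a : R) (n : ℕ) : rP Q a (n+1) = rP Q a n * (1 - a * Q^n) := by
  simp [rP, Finset.prod_range_succ]
lemma rP_succ' (Q a : R) (n : ℕ) : rP Q a (n+1) = (1 - a) * rP Q (a*Q) n := by
  simp only [rP, Finset.prod_range_succ', pow_zero, mul_one]
  rw [mul_comm]; congr 1
  refine Finset.prod_congr rfl fun m _ => ?_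
  rw [pow_succ']; ring

lemma I_step {Q a : R} {I : ℕ → R} (hI : ∀ N, I N * rP Q a N = 1) (N : ℕ) :
    I N = I (N+1) * (1 - a * Q^N) := by
  have h1 := hI N
  have h2 := hI (N+1)
  rw [rP_succ] at h2
  calc I N = I N * (I (N+1) * (rP Q a N * (1 - a * Q^N))) := by rw [h2, mul_one]
    _ = (I N * rP Q a N) * (I (N+1) * (1 - a * Q^N)) := by ring
    _ = _ := by rw [h1, one_mul]

lemma I_shift {Q a : R} {I : ℕ → R} (hI : ∀ N, I N * rP Q a N = 1) (N : ℕ) :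
    ((1 - a) * I (N+1)) * rP Q (a*Q) N = 1 := by
  have h2 := hI (N+1)
  rw [rP_succ'] at h2
  linear_combination h2

lemma I_cancel {Q a : R} {I : ℕ → R} (hI : ∀ N, I N * rP Q a N = 1) {u v : R}
    (h : (1 - a) * u = (1 - a) * v) : u = v := by
  have h2 := hI 1
  rw [rP_succ, rP_zero] at h2
  simp only [pow_zero, mul_one, one_mul] at h2
  calc u = (I 1 * (1 - a)) * u := by rw [h2, one_mul]
    _ = I 1 * ((1 - a) * u) := by ring
    _ = I 1 * ((1 - a) * v) := by rw [h]
    _ = (I 1 * (1 - a)) * v := by ring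
    _ = v := by rw [h2, one_mul]

variable [Algebra ℝ R]

lemma durfee {q : ℝ} (h0 : 0 < q) (h1 : q < 1) (N : ℕ) : ∀ (a : R) (I : ℕ → R)
    (_ : ∀ N, I N * rP (algebraMap ℝ R q) a N = 1),
    ∑ M ∈ range (N+1), a^M * algebraMap ℝ R (q^(M*(M-1)) * gb q N M) * I M = I N := by
  induction N with
  | zero => intro a I hI; simp [gb_zero h0 h1]
  | succ N ih =>
    intro a I hI
    rw [Finset.sum_range_succ']
    have h3 : ∀ M ∈ range (N+1), a^(M+1) * algebraMap ℝ R (q^((M+1)*(M+1-1)) * gb q (N+1) (M+1)) * I (M+1)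
        = a^(M+1) * algebraMap ℝ R (q^((M+1)*(M+1-1)) * gb q N (M+1)) * I (M+1)
          + a * algebraMap ℝ R (q^N) * ((a * algebraMap ℝ R q)^M * algebraMap ℝ R (q^(M*(M-1)) * gb q N M) * I (M+1)) := by
      intro M hM
      have hM : M ≤ N := by simpa [Nat.lt_succ_iff] using hM
      rw [gb_succ h0 h1 hM]
      have e : q^((M+1)*(M+1-1)) * q^(N-M) = q^N * q^M * q^(M*(M-1)) := by
        rw [← pow_add, ← pow_add, ← pow_add]
        congr 1
        obtain ⟨t, rfl⟩ := Nat.exists_eq_add_of_le hM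
        rcases M with _ | M
        · simp
        · simp; ring
      rw [mul_add, map_add, ← mul_assoc (q^((M+1)*(M+1-1))) (q^(N-M)), e]
      simp only [map_mul, map_pow, mul_pow]
      ring
    rw [Finset.sum_congr rfl h3, Finset.sum_add_distrib, ← Finset.mul_sum]
    have h4 := ih (a * algebraMap ℝ R q) (fun M => (1 - a) * I (M+1)) (I_shift hI)
    have h5 : ∑ M ∈ range (N+1), (a * algebraMap ℝ R q)^M * algebraMap ℝ R (q^(M*(M-1)) * gb q N M) * I (M+1) = I (N+1) := by
      apply I_cancel hI
      rw [← h4, Finset.mul_sum]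
      exact Finset.sum_congr rfl fun M _ => by ring
    rw [h5]
    have h6 := ih a I hI
    have h7 : ∑ M ∈ range (N+2), a^M * algebraMap ℝ R (q^(M*(M-1)) * gb q N M) * I M = I N := by
      rw [Finset.sum_range_succ, h6, gb_gt (Nat.lt_succ_self N)]; simp
    rw [Finset.sum_range_succ'] at h7
    have h8 := I_step hI N
    simp only [gb_zero h0 h1] at h7 ⊢
    rw [h8] at h7
    rw [map_pow]
    linear_combination h7

lemma vander {q : ℝ} (h0 : 0 < q) (h1 : q < 1) (x : R) (n : ℕ) : ∀ (a : R) (I : ℕ → R)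
    (_ : ∀ N, I N * rP (algebraMap ℝ R q) (a*x) N = 1),
    ∑ N ∈ range (n+1), (-x)^N * algebraMap ℝ R (q^(N.choose 2) * gb q n N) * rP (algebraMap ℝ R q) a N * I N
      = rP (algebraMap ℝ R q) x n * I n := by
  induction n with
  | zero => intro a I hI; simp [gb_zero h0 h1, rP_zero]
  | succ n ih =>
    intro a I hI
    set Q := algebraMap ℝ R q with hQ
    rw [Finset.sum_range_succ']
    have h3 : ∀ N ∈ range (n+1), (-x)^(N+1) * algebraMap ℝ R (q^((N+1).choose 2) * gb q (n+1) (N+1)) * rP Q a (N+1) * I (N+1)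
        = (-x)^(N+1) * algebraMap ℝ R (q^((N+1).choose 2) * gb q n (N+1)) * rP Q a (N+1) * I (N+1)
          + (-x) * Q^n * (1 - a) * ((-x)^N * algebraMap ℝ R (q^(N.choose 2) * gb q n N) * rP Q (a*Q) N * I (N+1)) := by
      intro N hN
      have hN : N ≤ n := by simpa [Nat.lt_succ_iff] using hN
      rw [gb_succ h0 h1 hN, rP_succ' Q a N]
      have e : q^((N+1).choose 2) * q^(n-N) = q^n * q^(N.choose 2) := by
        rw [← pow_add, ← pow_add]
        congr 1
        have : (N+1).choose 2 = N.choose 2 + N := by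
          rw [Nat.choose_succ_succ' N 1]; simp [add_comm]
        omega
      rw [mul_add, map_add, ← mul_assoc (q^((N+1).choose 2)) (q^(n-N)), e]
      simp only [map_mul, map_pow, ← hQ]
      ring
    rw [Finset.sum_congr rfl h3, Finset.sum_add_distrib, ← Finset.mul_sum]
    have h4 := ih (a * Q) (fun M => (1 - a*x) * I (M+1)) (by
      intro N
      have := I_shift hI N
      rwa [mul_right_comm a x Q] at this)
    have h5 : ∑ N ∈ range (n+1), (-x)^N * algebraMap ℝ R (q^(N.choose 2) * gb q n N) * rP Q (a*Q) N * I (N+1) = rP Q x n * I (n+1) := by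
      apply I_cancel hI
      calc _ = _ := by
            rw [Finset.mul_sum]
            exact Finset.sum_congr rfl fun M _ => by ring
        _ = _ := h4
        _ = _ := by ring
    rw [h5]
    have h6 := ih a I hI
    have h7 : ∑ N ∈ range (n+2), (-x)^N * algebraMap ℝ R (q^(N.choose 2) * gb q n N) * rP Q a N * I N = rP Q x n * I n := by
      rw [Finset.sum_range_succ, h6, gb_gt (Nat.lt_succ_self n)]; simp
    rw [Finset.sum_range_succ'] at h7
    have h8 := I_step hI n
    simp only [gb_zero h0 h1] at h7 ⊢
    rw [h8] at h7
    rw [rP_succ]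
    linear_combination h7

lemma durfee1 {q : ℝ} (h0 : 0 < q) (h1 : q < 1) (N : ℕ) (a : R) (I : ℕ → R)
    (hI : ∀ N, I N * rP (algebraMap ℝ R q) a N = 1) :
    ∑ M ∈ range (N+1), (a * algebraMap ℝ R q)^M * algebraMap ℝ R (q^(M*(M-1)) * gb q N M) * I (M+1) = I (N+1) := by
  have h4 := durfee h0 h1 N (a * algebraMap ℝ R q) (fun M => (1 - a) * I (M+1)) (I_shift hI)
  apply I_cancel hI
  rw [← h4, Finset.mul_sum]
  exact Finset.sum_congr rfl fun M _ => by ring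

lemma durfee2 {q : ℝ} (h0 : 0 < q) (h1 : q < 1) (N : ℕ) (a : R) (I : ℕ → R)
    (hI : ∀ N, I N * rP (algebraMap ℝ R q) a N = 1) :
    ∑ M ∈ range (N+1), (a * algebraMap ℝ R q * algebraMap ℝ R q)^M * algebraMap ℝ R (q^(M*(M-1)) * gb q N M) * I (M+2) = I (N+2) := by
  have h4 := durfee1 h0 h1 N (a * algebraMap ℝ R q) (fun M => (1 - a) * I (M+1)) (I_shift hI)
  apply I_cancel hI
  rw [← h4, Finset.mul_sum]
  exact Finset.sum_congr rfl fun M _ => by ring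

lemma vander2 {q : ℝ} (h0 : 0 < q) (h1 : q < 1) (y : R) (n : ℕ) (I : ℕ → R)
    (hI : ∀ N, I N * rP (algebraMap ℝ R q) (y^2) N = 1) :
    ∑ N ∈ range (n+1), (y * algebraMap ℝ R q)^N * algebraMap ℝ R (q^(N.choose 2) * gb q n N) *
        rP (algebraMap ℝ R q) (-y * algebraMap ℝ R q) N * I (N+2)
      = rP (algebraMap ℝ R q) (-y * algebraMap ℝ R q) n * I (n+2) := by
  set Q := algebraMap ℝ R q with hQ
  have h4 := vander h0 h1 (-y * Q) n (-y * Q) (fun M => (1 - y^2 * Q) * ((1 - y^2) * I (M+2))) (by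
    intro N
    have := I_shift (I_shift hI) N
    rw [show -y * Q * (-y * Q) = y^2 * Q * Q by ring]
    exact this)
  apply I_cancel hI
  apply I_cancel (I_shift hI)
  calc _ = _ := by
        rw [Finset.mul_sum, Finset.mul_sum]
        exact Finset.sum_congr rfl fun M _ => by
          rw [show y * Q = -(-y * Q) by ring]; ring
    _ = _ := h4
    _ = _ := by ring
end generic
end

noncomputable section
open Finset

open PowerSeries in
/-- coefficients of 1/(z)_N -/
def CC (q : ℝ) (N i : ℕ) : ℝ := qP q (q^N) i / qP q q i

lemma qP_shift (q a : ℝ) (n : ℕ) : qP q a (n+1) = (1 - a) * qP q (a*q) n := rP_succ' q a n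

lemma CC_rec {q : ℝ} (h0 : 0 < q) (h1 : q < 1) (N i : ℕ) :
    CC q (N+1) (i+1) - q^N * CC q (N+1) i = CC q N (i+1) := by
  unfold CC
  rw [qP_shift q (q^N) i, ← pow_succ, qq_succ, qP_succ q (q^(N+1)) i]
  have := qq_ne h0 h1 i; have := one_sub_ne h0 h1 i
  field_simp
  ring

lemma CC_zero (q : ℝ) (N : ℕ) : CC q N 0 = 1 := by simp [CC, qP_zero]
lemma CC_zero_succ (q : ℝ) (i : ℕ) : CC q 0 (i+1) = 0 := by simp [CC, qP_shift]

lemma CC_tendsto {q : ℝ} (h0 : 0 < q) (h1 : q < 1) (i : ℕ) :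
    Filter.Tendsto (fun n => CC q n i) Filter.atTop (nhds (qP q q i)⁻¹) := by
  unfold CC
  have : Filter.Tendsto (fun n => qP q (q^n) i) Filter.atTop (nhds 1) := by
    unfold qP
    have h : ∀ m ∈ range i, Filter.Tendsto (fun n => 1 - q^n * q^m) Filter.atTop (nhds (1 - 0 * q^m)) :=
      fun m _ => ((tendsto_pow_atTop_nhds_zero_of_lt_one h0.le h1).mul_const _).const_sub 1
    simpa using tendsto_finsetProd _ h
  simpa using this.div_const (qP q q i)

open PowerSeries

def II (q : ℝ) (N : ℕ) : PowerSeries ℝ :=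
  PowerSeries.mk fun c => if Even c then CC q N (c/2) else 0

lemma II_zero (q : ℝ) : II q 0 = 1 := by
  ext c
  rw [II, coeff_mk, coeff_one]
  rcases c with _ | c
  · simp [CC_zero]
  · simp only [Nat.add_eq_zero_iff, one_ne_zero, and_false, if_false]
    split_ifs with h
    · obtain ⟨t, ht⟩ := h
      obtain ⟨t, rfl⟩ : ∃ t', t = t'+1 := ⟨t-1, by omega⟩
      rw [show (c+1)/2 = t+1 by omega, CC_zero_succ]
    · rfl

lemma am_eq (x : ℝ) : algebraMap ℝ (PowerSeries ℝ) x = PowerSeries.C x := rfl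

lemma II_step {q : ℝ} (h0 : 0 < q) (h1 : q < 1) (N : ℕ) :
    II q (N+1) * (1 - X^2 * (algebraMap ℝ (PowerSeries ℝ) q)^N) = II q N := by
  ext c
  rw [show II q (N+1) * (1 - X^2 * (algebraMap ℝ (PowerSeries ℝ) q)^N)
    = II q (N+1) - PowerSeries.C (q^N) * (X^2 * II q (N+1)) by
      rw [am_eq, map_pow]; ring]
  rw [map_sub, coeff_C_mul, coeff_X_pow_mul']
  simp only [II, coeff_mk]
  by_cases hc : 2 ≤ c
  · obtain ⟨e, rfl⟩ := Nat.exists_eq_add_of_le' hc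
    by_cases he : Even e
    · have : Even (e+2) := he.add (by decide)
      simp only [hc, he, this, if_true, Nat.add_sub_cancel]
      rw [show (e+2)/2 = e/2+1 by omega]
      exact CC_rec h0 h1 N _
    · have : ¬ Even (e+2) := by rwa [Nat.even_add, iff_true_right (by decide)]
      simp [he, this]
  · interval_cases c <;> simp [CC_zero]

lemma II_inv {q : ℝ} (h0 : 0 < q) (h1 : q < 1) (N : ℕ) :
    II q N * rP (algebraMap ℝ (PowerSeries ℝ) q) (X^2) N = 1 := by
  induction N with
  | zero => simp [II_zero, rP_zero]
  | succ N ih =>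
    rw [← II_step h0 h1 N] at ih
    rw [rP_succ]; linear_combination ih

def Fs (q : ℝ) (l N : ℕ) : PowerSeries ℝ :=
  II q N - X^(2*l) * algebraMap ℝ _ (1 - q^N) * II q (N+1)

lemma Fs_durfee {q : ℝ} (h0 : 0 < q) (h1 : q < 1) (l N : ℕ) :
    ∑ M ∈ range (N+1), (X^2)^M * algebraMap ℝ (PowerSeries ℝ) (q^(M*(M-1)) * gb q N M) * Fs q l M
      = Fs q (l+1) N := by
  have hU := durfee h0 h1 N (X^2) (II q) (II_inv h0 h1)
  have hW : ∑ M ∈ range (N+1), (X^2)^M * algebraMap ℝ (PowerSeries ℝ) (q^(M*(M-1)) * gb q N M) *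
      (algebraMap ℝ _ (1 - q^M) * II q (M+1)) = X^2 * algebraMap ℝ _ (1 - q^N) * II q (N+1) := by
    rcases N with _ | n
    · simp
    · rw [Finset.sum_range_succ']
      have h2 := durfee2 h0 h1 n (X^2) (II q) (II_inv h0 h1)
      rw [← h2, Finset.mul_sum]
      simp only [pow_zero, sub_self, map_zero, zero_mul, mul_zero, add_zero]
      refine Finset.sum_congr rfl fun M _ => ?_
      have e : q^((M+1)*(M+1-1)) * gb q (n+1) (M+1) * (1 - q^(M+1)) = (1 - q^(n+1)) * (q*q)^M * (q^(M*(M-1)) * gb q n M) := by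
        rw [mul_assoc, gb_absorb h0 h1]
        have : q^((M+1)*(M+1-1)) = (q*q)^M * q^(M*(M-1)) := by
          rw [← pow_two, ← pow_mul, ← pow_add]; congr 1
          rcases M with _ | M
          · simp
          · simp; ring
        rw [this]; ring
      have e' := congrArg (algebraMap ℝ (PowerSeries ℝ)) e
      simp only [map_mul, map_pow, mul_pow] at e' ⊢
      linear_combination (X^2)^(M+1) * II q (M+2) * e'
  unfold Fs
  rw [show II q N - X^(2*(l+1)) * algebraMap ℝ _ (1 - q^N) * II q (N+1)
    = II q N - X^(2*l) * (X^2 * algebraMap ℝ _ (1 - q^N) * II q (N+1)) by ring, ← hW, mul_sum]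
  conv_rhs => rw [← hU]
  rw [← sum_sub_distrib]
  exact Finset.sum_congr rfl fun M _ => by ring

lemma Fs_one {q : ℝ} (h0 : 0 < q) (h1 : q < 1) (N : ℕ) :
    algebraMap ℝ _ (q^N) * Fs q 1 N = Fs q 0 N := by
  unfold Fs
  rw [← II_step h0 h1 N]
  simp only [map_sub, map_one, map_pow]
  ring

lemma Fs_zero (q : ℝ) (l : ℕ) : Fs q l 0 = 1 := by simp [Fs, II_zero]

lemma K_fin {q : ℝ} (h0 : 0 < q) (h1 : q < 1) (l n : ℕ) :
    ∑ N ∈ range (n+1), X^N * algebraMap ℝ (PowerSeries ℝ) (q^(N.choose 2) * gb q n N) *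
        rP (algebraMap ℝ _ q) (-X) N * Fs q l N
      = rP (algebraMap ℝ _ q) (-X) n * II q n
        - X^(2*l+1) * algebraMap ℝ _ (1 - q^n) * (rP (algebraMap ℝ _ q) (-X) n * II q (n+1)) := by
  have hU := vander h0 h1 (-X : PowerSeries ℝ) n (-X) (II q) (by
    intro N; rw [show (-X : PowerSeries ℝ) * -X = X^2 by ring]; exact II_inv h0 h1 N)
  have hW : ∑ N ∈ range (n+1), X^N * algebraMap ℝ (PowerSeries ℝ) (q^(N.choose 2) * gb q n N) *
        rP (algebraMap ℝ _ q) (-X) N * (algebraMap ℝ _ (1 - q^N) * II q (N+1))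
      = X * algebraMap ℝ _ (1 - q^n) * (rP (algebraMap ℝ _ q) (-X) n * II q (n+1)) := by
    rcases n with _ | n
    · simp
    · rw [Finset.sum_range_succ']
      have h2 := vander2 h0 h1 (X : PowerSeries ℝ) n (II q) (II_inv h0 h1)
      rw [rP_succ' _ _ n]
      rw [show X * algebraMap ℝ _ (1 - q^(n+1)) * ((1 - (-X)) * rP (algebraMap ℝ _ q) (-X * algebraMap ℝ _ q) n * II q (n+1+1))
        = X * algebraMap ℝ _ (1 - q^(n+1)) * (1 - (-X)) * (rP (algebraMap ℝ _ q) (-X * algebraMap ℝ _ q) n * II q (n+2)) by ring]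
      rw [← h2, Finset.mul_sum]
      simp only [pow_zero, sub_self, map_zero, zero_mul, mul_zero, add_zero]
      refine Finset.sum_congr rfl fun M _ => ?_
      have e : q^((M+1).choose 2) * gb q (n+1) (M+1) * (1 - q^(M+1)) = (1 - q^(n+1)) * q^M * (q^(M.choose 2) * gb q n M) := by
        rw [mul_assoc, gb_absorb h0 h1]
        have : (M+1).choose 2 = M.choose 2 + M := by
          rw [Nat.choose_succ_succ' M 1]; simp [add_comm]
        rw [this, pow_add]; ring
      have e' := congrArg (algebraMap ℝ (PowerSeries ℝ)) e
      rw [rP_succ' _ _ M]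
      simp only [map_mul, map_pow, mul_pow] at e' ⊢
      linear_combination X^(M+1) * (1 - (-X)) * rP (algebraMap ℝ _ q) (-X * algebraMap ℝ _ q) M * II q (M+2) * e'
  unfold Fs
  rw [show X^(2*l+1) * algebraMap ℝ _ (1 - q^n) * (rP (algebraMap ℝ _ q) (-X) n * II q (n+1))
    = X^(2*l) * (X * algebraMap ℝ _ (1 - q^n) * (rP (algebraMap ℝ _ q) (-X) n * II q (n+1))) by ring, ← hW, ← hU, mul_sum,
    ← sum_sub_distrib]
  exact Finset.sum_congr rfl fun M _ => by rw [neg_neg]; ring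

lemma coeff_rP {q : ℝ} (h0 : 0 < q) (h1 : q < 1) (n s : ℕ) :
    coeff s (rP (algebraMap ℝ (PowerSeries ℝ) q) (-X) n) = gb q n s * q^(s.choose 2) := by
  induction n generalizing s with
  | zero =>
    rw [rP_zero, coeff_one]
    rcases s with _ | s
    · simp [gb_zero h0 h1]
    · simp [gb_gt]
  | succ n ih =>
    rw [rP_succ, show rP (algebraMap ℝ (PowerSeries ℝ) q) (-X) n * (1 - -X * (algebraMap ℝ _ q)^n)
      = rP (algebraMap ℝ (PowerSeries ℝ) q) (-X) n + PowerSeries.C (q^n) * (X * rP (algebraMap ℝ (PowerSeries ℝ) q) (-X) n) by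
        simp only [am_eq, map_pow]; ring]
    rw [map_add, coeff_C_mul, ih]
    rcases s with _ | s
    · simp [gb_zero h0 h1]
    · rw [coeff_succ_X_mul, ih]
      have : (s+1).choose 2 = s.choose 2 + s := by
        rw [Nat.choose_succ_succ' s 1]; simp [add_comm]
      by_cases h : s ≤ n
      · rw [gb_succ h0 h1 h, this]
        obtain ⟨t, rfl⟩ := Nat.exists_eq_add_of_le h
        simp only [Nat.add_sub_cancel_left, pow_add]
        ring
      · rw [gb_gt (by omega), gb_gt (by omega), gb_gt (by omega)]; simp

/-- limiting coefficient of (-y)_∞/(y²)_∞ -/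
def vv (q : ℝ) (c : ℕ) : ℝ := ∑ p ∈ antidiagonal c,
  ((qP q q p.1)⁻¹ * q^(p.1.choose 2)) * (if Even p.2 then (qP q q (p.2/2))⁻¹ else 0)

lemma vv_tendsto {q : ℝ} (h0 : 0 < q) (h1 : q < 1) (c t : ℕ) :
    Filter.Tendsto (fun n => coeff c (rP (algebraMap ℝ (PowerSeries ℝ) q) (-X) n * II q (n+t)))
      Filter.atTop (nhds (vv q c)) := by
  simp only [coeff_mul]
  refine tendsto_finsetSum _ fun p _ => ?_
  simp only [coeff_rP h0 h1, II, coeff_mk]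
  refine ((gb_tendsto h0 h1 _).mul_const _).mul ?_
  split_ifs
  · exact (CC_tendsto h0 h1 _).comp (Filter.tendsto_add_atTop_nat t)
  · exact tendsto_const_nhds

lemma K_lim {q : ℝ} (h0 : 0 < q) (h1 : q < 1) (l c : ℕ) :
    ∑ N ∈ range (c+1), q^(N.choose 2) * (qP q q N)⁻¹ *
      coeff c (X^N * (rP (algebraMap ℝ (PowerSeries ℝ) q) (-X) N * Fs q l N))
      = vv q c - (if 2*l+1 ≤ c then vv q (c - (2*l+1)) else 0) := by
  have hL : Filter.Tendsto (fun n => coeff c (∑ N ∈ range (n+1), X^N * algebraMap ℝ (PowerSeries ℝ) (q^(N.choose 2) * gb q n N) *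
        rP (algebraMap ℝ _ q) (-X) N * Fs q l N)) Filter.atTop
      (nhds (∑ N ∈ range (c+1), q^(N.choose 2) * (qP q q N)⁻¹ *
      coeff c (X^N * (rP (algebraMap ℝ (PowerSeries ℝ) q) (-X) N * Fs q l N)))) := by
    have : Filter.Tendsto (fun n => ∑ N ∈ range (c+1), q^(N.choose 2) * gb q n N *
      coeff c (X^N * (rP (algebraMap ℝ (PowerSeries ℝ) q) (-X) N * Fs q l N))) Filter.atTop
      (nhds (∑ N ∈ range (c+1), q^(N.choose 2) * (qP q q N)⁻¹ *
      coeff c (X^N * (rP (algebraMap ℝ (PowerSeries ℝ) q) (-X) N * Fs q l N)))) :=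
      tendsto_finsetSum _ fun N _ => ((gb_tendsto h0 h1 N).const_mul _).mul_const _
    refine this.congr' ?_
    filter_upwards [Filter.eventually_ge_atTop c] with n hn
    rw [map_sum]
    have e : ∀ N, coeff c (X^N * algebraMap ℝ (PowerSeries ℝ) (q^(N.choose 2) * gb q n N) *
        rP (algebraMap ℝ _ q) (-X) N * Fs q l N) = q^(N.choose 2) * gb q n N *
      coeff c (X^N * (rP (algebraMap ℝ (PowerSeries ℝ) q) (-X) N * Fs q l N)) := by
      intro N
      rw [← coeff_C_mul, am_eq]; congr 1; ring
    simp only [e]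
    refine Finset.sum_subset (range_subset_range.2 (by omega)) fun N _ hN => ?_
    rw [coeff_X_pow_mul', if_neg (by simpa using hN), mul_zero]
  have hR : Filter.Tendsto (fun n => coeff c (rP (algebraMap ℝ (PowerSeries ℝ) q) (-X) n * II q n
        - X^(2*l+1) * algebraMap ℝ _ (1 - q^n) * (rP (algebraMap ℝ _ q) (-X) n * II q (n+1)))) Filter.atTop
      (nhds (vv q c - (if 2*l+1 ≤ c then vv q (c - (2*l+1)) else 0))) := by
    simp only [map_sub (coeff c)]
    refine (vv_tendsto h0 h1 c 0).sub ?_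
    have e : ∀ n, coeff c (X^(2*l+1) * algebraMap ℝ (PowerSeries ℝ) (1 - q^n) * (rP (algebraMap ℝ _ q) (-X) n * II q (n+1)))
      = (1 - q^n) * if 2*l+1 ≤ c then coeff (c - (2*l+1)) (rP (algebraMap ℝ (PowerSeries ℝ) q) (-X) n * II q (n+1)) else 0 := by
      intro n
      rw [← coeff_X_pow_mul', ← coeff_C_mul, am_eq]; congr 1; ring
    simp only [e]
    have h3 : Filter.Tendsto (fun n => 1 - q^n) Filter.atTop (nhds 1) := by
      simpa using (tendsto_pow_atTop_nhds_zero_of_lt_one h0.le h1).const_sub 1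
    have h4 : Filter.Tendsto (fun n => if 2*l+1 ≤ c then coeff (c - (2*l+1)) (rP (algebraMap ℝ (PowerSeries ℝ) q) (-X) n * II q (n+1)) else 0)
      Filter.atTop (nhds (if 2*l+1 ≤ c then vv q (c - (2*l+1)) else 0)) := by
      split_ifs
      · exact vv_tendsto h0 h1 _ 1
      · exact tendsto_const_nhds
    simpa using h3.mul h4
  refine tendsto_nhds_unique hL ?_
  simpa only [K_fin h0 h1] using hR

/-- explicit alpha -/
def alS (q : ℝ) (l N d : ℕ) : ℝ :=
  if N ≤ d then q^(N*(N-1)) * (qP q q N)⁻¹ * coeff (2*(d-N)) (Fs q l N) else 0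

lemma alS_zero (q : ℝ) (l d : ℕ) : alS q l 0 d = if d = 0 then 1 else 0 := by
  simp [alS, Fs_zero, qP_zero, coeff_one]

lemma alS_sum {q : ℝ} (h0 : 0 < q) (h1 : q < 1) (l N e : ℕ) :
    ∑ M ∈ range (N+1), (qP q q (N-M))⁻¹ * alS q l M e
      = (qP q q N)⁻¹ * coeff (2*e) (Fs q (l+1) N) := by
  rw [← Fs_durfee h0 h1, map_sum, mul_sum]
  refine Finset.sum_congr rfl fun M hM => ?_
  have hM : M ≤ N := by simpa [Nat.lt_succ_iff] using hM
  rw [show (X^2)^M * algebraMap ℝ (PowerSeries ℝ) (q^(M*(M-1)) * gb q N M) * Fs q l M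
    = PowerSeries.C (q^(M*(M-1)) * gb q N M) * (X^(2*M) * Fs q l M) by rw [am_eq, pow_mul]; ring,
    coeff_C_mul, coeff_X_pow_mul', alS, gb, if_pos hM]
  have := qq_ne h0 h1 N; have := qq_ne h0 h1 M; have := qq_ne h0 h1 (N-M)
  by_cases h : M ≤ e
  · rw [if_pos h, if_pos (by omega), show 2*e - 2*M = 2*(e-M) by omega]
    field_simp
  · rw [if_neg h, if_neg (by omega)]; simp

lemma alS_rec {q : ℝ} (h0 : 0 < q) (h1 : q < 1) (l N e : ℕ) :
    alS q (l+1) N (N+e) = q^(N*(N-1)) * ∑ M ∈ range (N+1), (qP q q (N-M))⁻¹ * alS q l M e := by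
  rw [alS_sum h0 h1, alS, if_pos (by omega), Nat.add_sub_cancel_left]; ring

lemma alS_rec0 {q : ℝ} (h0 : 0 < q) (h1 : q < 1) (N e : ℕ) :
    alS q 0 N (N+e) = q^(N*N) * ∑ M ∈ range (N+1), (qP q q (N-M))⁻¹ * alS q 0 M e := by
  rw [alS_sum h0 h1, alS, if_pos (by omega), Nat.add_sub_cancel_left, ← Fs_one h0 h1, am_eq, coeff_C_mul]
  have : q^(N*N) = q^(N*(N-1)) * q^N := by
    rw [← pow_add]; congr 1
    rcases N with _ | N
    · simp
    · simp; ring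
  rw [this]; ring

lemma alS_tot {q : ℝ} (h0 : 0 < q) (h1 : q < 1) (j : ℕ) :
    ∑ N ∈ range (j+1), alS q 0 N j = q^j * (qP q q j)⁻¹ := by
  have e : ∀ n N, gb q n N * q^(N*(N-1)) * (if N ≤ j then coeff (2*(j-N)) (Fs q 0 N) else 0) =
      coeff (2*j) ((X^2)^N * algebraMap ℝ (PowerSeries ℝ) (q^(N*(N-1)) * gb q n N) * Fs q 0 N) := by
    intro n N
    rw [show (X^2)^N * algebraMap ℝ (PowerSeries ℝ) (q^(N*(N-1)) * gb q n N) * Fs q 0 N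
      = PowerSeries.C (q^(N*(N-1)) * gb q n N) * (X^(2*N) * Fs q 0 N) by rw [am_eq, pow_mul]; ring,
      coeff_C_mul, coeff_X_pow_mul']
    by_cases h : N ≤ j
    · rw [if_pos h, if_pos (by omega), show 2*j - 2*N = 2*(j-N) by omega]; ring
    · rw [if_neg h, if_neg (by omega)]; simp
  have hL : Filter.Tendsto (fun n => coeff (2*j) (Fs q 1 n)) Filter.atTop (nhds (∑ N ∈ range (j+1), alS q 0 N j)) := by
    have : Filter.Tendsto (fun n => ∑ N ∈ range (j+1), gb q n N * q^(N*(N-1)) * (if N ≤ j then coeff (2*(j-N)) (Fs q 0 N) else 0))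
      Filter.atTop (nhds (∑ N ∈ range (j+1), (qP q q N)⁻¹ * q^(N*(N-1)) * (if N ≤ j then coeff (2*(j-N)) (Fs q 0 N) else 0))) :=
      tendsto_finsetSum _ fun N _ => ((gb_tendsto h0 h1 N).mul_const _).mul_const _
    have e2 : ∑ N ∈ range (j+1), (qP q q N)⁻¹ * q^(N*(N-1)) * (if N ≤ j then coeff (2*(j-N)) (Fs q 0 N) else 0) = ∑ N ∈ range (j+1), alS q 0 N j := by
      refine Finset.sum_congr rfl fun N _ => ?_
      unfold alS
      split_ifs <;> ring
    rw [e2] at this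
    refine this.congr' ?_
    filter_upwards [Filter.eventually_ge_atTop j] with n hn
    rw [← Fs_durfee h0 h1 0 n, map_sum]
    simp only [← e]
    refine Finset.sum_subset (range_subset_range.2 (by omega)) fun N _ hN => ?_
    rw [if_neg (by simpa [Nat.lt_succ_iff] using hN), mul_zero]
  have hR : Filter.Tendsto (fun n => coeff (2*j) (Fs q 1 n)) Filter.atTop (nhds (q^j * (qP q q j)⁻¹)) := by
    have e3 : ∀ n, coeff (2*j) (Fs q 1 n) = CC q n j - (1 - q^n) * (if 1 ≤ j then CC q (n+1) (j-1) else 0) := by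
      intro n
      rw [Fs, show X^(2*1) * algebraMap ℝ (PowerSeries ℝ) (1 - q^n) * II q (n+1) = PowerSeries.C (1 - q^n) * (X^2 * II q (n+1)) by
        rw [am_eq]; ring, map_sub, coeff_C_mul, coeff_X_pow_mul']
      simp only [II, coeff_mk]
      rcases j with _ | j
      · simp
      · have a1 : Even (2*(j+1)) := by simp
        have a2 : Even (2*(j+1) - 2) := ⟨j, by omega⟩
        have a3 : 2 ≤ 2*(j+1) := by omega
        have a4 : 1 ≤ j+1 := by omega
        have a5 : 2*(j+1)/2 = j+1 := by omega
        have a6 : (2*(j+1)-2)/2 = j+1-1 := by omega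
        rw [if_pos a1, if_pos a3, if_pos a2, if_pos a4, a5, a6]
    simp only [e3]
    have h3 : Filter.Tendsto (fun n => 1 - q^n) Filter.atTop (nhds 1) := by
      simpa using (tendsto_pow_atTop_nhds_zero_of_lt_one h0.le h1).const_sub 1
    rcases j with _ | j
    · simpa [qP_zero] using CC_tendsto h0 h1 0
    · have h4 := (CC_tendsto h0 h1 (j+1)).sub (h3.mul ((CC_tendsto h0 h1 j).comp (Filter.tendsto_add_atTop_nat 1)))
      have e5 : (qP q q (j+1))⁻¹ - 1 * (qP q q j)⁻¹ = q^(j+1) * (qP q q (j+1))⁻¹ := by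
        rw [qq_succ]
        have := qq_ne h0 h1 j; have := one_sub_ne h0 h1 j
        field_simp; ring
      rw [e5] at h4
      simpa using h4
  exact tendsto_nhds_unique hL hR
end

noncomputable section
open Finset

def A1 (a : ℕ →₀ ℕ) : ℕ := a.sum fun _ m => m
def Wt (a : ℕ →₀ ℕ) : ℕ := a.sum fun i m => (i+1)*m
def QQ (a : ℕ →₀ ℕ) : ℕ := a.sum fun i m => a.sum fun j m' => min (i+1) (j+1) * m * m'
def PP (l : ℕ) (a : ℕ →₀ ℕ) : ℕ := a.sum fun i m => min (i+1) l * m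
def wA (q : ℝ) (a : ℕ →₀ ℕ) : ℝ := a.prod fun _ m => (qP q q m)⁻¹

lemma exists_supp (a : ℕ →₀ ℕ) : ∃ H, a.support ⊆ range H :=
  ⟨a.support.sup id + 1, fun i hi => by
    simpa [Nat.lt_succ_iff] using Finset.le_sup (f := id) hi⟩

lemma A1_range {a : ℕ →₀ ℕ} {H : ℕ} (h : a.support ⊆ range H) : A1 a = ∑ i ∈ range H, a i :=
  Finsupp.sum_of_support_subset _ h _ (by simp)
lemma Wt_range {a : ℕ →₀ ℕ} {H : ℕ} (h : a.support ⊆ range H) :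
    Wt a = ∑ i ∈ range H, (i+1) * a i :=
  Finsupp.sum_of_support_subset _ h _ (by simp)
lemma PP_range (l : ℕ) {a : ℕ →₀ ℕ} {H : ℕ} (h : a.support ⊆ range H) :
    PP l a = ∑ i ∈ range H, min (i+1) l * a i :=
  Finsupp.sum_of_support_subset _ h _ (by simp)
lemma QQ_range {a : ℕ →₀ ℕ} {H : ℕ} (h : a.support ⊆ range H) :
    QQ a = ∑ i ∈ range H, ∑ j ∈ range H, min (i+1) (j+1) * a i * a j := by
  unfold QQ
  rw [Finsupp.sum_of_support_subset _ h _ (by simp)]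
  exact Finset.sum_congr rfl fun i _ => Finsupp.sum_of_support_subset _ h _ (by simp)
lemma wA_range (q : ℝ) {a : ℕ →₀ ℕ} {H : ℕ} (h : a.support ⊆ range H) :
    wA q a = ∏ i ∈ range H, (qP q q (a i))⁻¹ :=
  Finsupp.prod_of_support_subset _ h _ (by simp [qP_zero])

lemma wA_pos {q : ℝ} (h0 : 0 < q) (h1 : q < 1) (a : ℕ →₀ ℕ) : 0 < wA q a :=
  Finset.prod_pos fun _ _ => inv_pos.2 (qq_pos h0 h1 _)

def consF (m : ℕ) (a : ℕ →₀ ℕ) : ℕ →₀ ℕ :=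
  Finsupp.single 0 m + Finsupp.embDomain ⟨Nat.succ, Nat.succ_injective⟩ a

lemma consF_zero (m : ℕ) (a : ℕ →₀ ℕ) : consF m a 0 = m := by
  simp only [consF, Finsupp.add_apply, Finsupp.single_eq_same]
  rw [Finsupp.embDomain_notin_range]
  · simp
  · simp

lemma consF_succ (m : ℕ) (a : ℕ →₀ ℕ) (i : ℕ) : consF m a (i+1) = a i := by
  have := Finsupp.embDomain_apply_self (⟨Nat.succ, Nat.succ_injective⟩ : ℕ ↪ ℕ) a i
  simp only [consF, Finsupp.add_apply]
  rw [Finsupp.single_eq_of_ne (by simp), zero_add]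
  exact this

def consE : ℕ × (ℕ →₀ ℕ) ≃ (ℕ →₀ ℕ) where
  toFun p := consF p.1 p.2
  invFun a := (a 0, a.comapDomain Nat.succ Nat.succ_injective.injOn)
  left_inv p := by
    refine Prod.ext (consF_zero _ _) ?_
    ext i
    simp [Finsupp.comapDomain_apply, consF_succ]
  right_inv a := by
    ext i
    rcases i with _ | i
    · simp [consF_zero]
    · simp [consF_succ, Finsupp.comapDomain_apply]

lemma consF_supp {a : ℕ →₀ ℕ} {H : ℕ} (h : a.support ⊆ range H) (m : ℕ) :
    (consF m a).support ⊆ range (H+1) := by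
  intro i hi
  rcases i with _ | i
  · simp
  · rw [Finsupp.mem_support_iff, consF_succ] at hi
    have := h (Finsupp.mem_support_iff.2 hi)
    simp at this ⊢; exact this

lemma A1_cons (m : ℕ) (a : ℕ →₀ ℕ) : A1 (consF m a) = m + A1 a := by
  obtain ⟨H, h⟩ := exists_supp a
  rw [A1_range (consF_supp h m), A1_range h, Finset.sum_range_succ']
  simp only [consF_zero, consF_succ]; ring
lemma Wt_cons (m : ℕ) (a : ℕ →₀ ℕ) : Wt (consF m a) = m + A1 a + Wt a := by
  obtain ⟨H, h⟩ := exists_supp a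
  rw [Wt_range (consF_supp h m), A1_range h, Wt_range h, Finset.sum_range_succ']
  simp only [consF_zero, consF_succ]
  simp only [add_mul, sum_add_distrib]; ring
lemma PP_cons (l m : ℕ) (a : ℕ →₀ ℕ) : PP l (consF m a) = min 1 l * (m + A1 a) + PP (l-1) a := by
  obtain ⟨H, h⟩ := exists_supp a
  rw [PP_range l (consF_supp h m), A1_range h, PP_range _ h, Finset.sum_range_succ']
  simp only [consF_zero, consF_succ]
  have : ∀ i, min (i+1+1) l = min 1 l + min (i+1) (l-1) := by intro i; omega
  simp only [this, add_mul, sum_add_distrib, mul_add, mul_sum, zero_add]; ring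
lemma QQ_cons (m : ℕ) (a : ℕ →₀ ℕ) : QQ (consF m a) = (m + A1 a)^2 + QQ a := by
  obtain ⟨H, h⟩ := exists_supp a
  rw [QQ_range (consF_supp h m), A1_range h, QQ_range h, Finset.sum_range_succ']
  simp only [Finset.sum_range_succ' _ H]
  simp only [consF_zero, consF_succ]
  have e1 : ∀ i j, min (i+1+1) (j+1+1) = 1 + min (i+1) (j+1) := by intro i j; omega
  have e2 : ∀ i, min (i+1+1) (0+1) = 1 := by intro i; omega
  have e3 : ∀ i, min (0+1) (i+1+1) = 1 := by intro i; omega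
  simp only [e1, e2, e3, add_mul, sum_add_distrib, one_mul, zero_add, min_self, ← mul_sum, ← sum_mul]
  ring
lemma wA_cons (q : ℝ) (m : ℕ) (a : ℕ →₀ ℕ) : wA q (consF m a) = (qP q q m)⁻¹ * wA q a := by
  obtain ⟨H, h⟩ := exists_supp a
  rw [wA_range q (consF_supp h m), wA_range q h, Finset.prod_range_succ']
  simp only [consF_zero, consF_succ]; ring

lemma A1_le_Wt (a : ℕ →₀ ℕ) : A1 a ≤ Wt a :=
  Finset.sum_le_sum fun i _ => by nlinarith [Nat.zero_le (i * a i)]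

lemma A1_eq_zero {a : ℕ →₀ ℕ} (h : A1 a = 0) : a = 0 := by
  ext i
  by_cases hi : i ∈ a.support
  · exact (Finset.sum_eq_zero_iff.1 h) i hi
  · simpa using hi

open ENNReal

def wL (q : ℝ) (l : ℕ) (a : ℕ →₀ ℕ) : ℝ := q^((QQ a : ℤ) - PP l a) * wA q a

lemma wL_nonneg {q : ℝ} (h0 : 0 < q) (h1 : q < 1) (l : ℕ) (a : ℕ →₀ ℕ) : 0 ≤ wL q l a :=
  mul_nonneg (zpow_nonneg h0.le _) (wA_pos h0 h1 a).le

def exl (l N : ℕ) : ℕ := if l = 0 then N*N else N*(N-1)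

lemma wL_cons {q : ℝ} (h0 : 0 < q) (l m : ℕ) (a : ℕ →₀ ℕ) :
    wL q l (consF m a) = q^(exl l (m + A1 a)) * ((qP q q m)⁻¹ * wL q (l-1) a) := by
  unfold wL
  rw [QQ_cons, PP_cons, wA_cons]
  have : (((m + A1 a)^2 + QQ a : ℕ) : ℤ) - ((min 1 l * (m + A1 a) + PP (l-1) a : ℕ) : ℤ)
      = (exl l (m + A1 a) : ℤ) + ((QQ a : ℤ) - PP (l-1) a) := by
    unfold exl
    generalize m + A1 a = N
    split_ifs with h
    · subst h; simp; ring
    · rw [show min 1 l = 1 by omega]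
      rcases N with _ | N
      · simp
      · simp only [Nat.add_sub_cancel]; push_cast; ring
  rw [this, zpow_add₀ h0.ne', zpow_natCast]; ring

def aE (q : ℝ) (l N d : ℕ) : ℝ≥0∞ :=
  ∑' a : ℕ →₀ ℕ, if A1 a = N ∧ Wt a = d then ENNReal.ofReal (wL q l a) else 0

lemma aE_rec {q : ℝ} (h0 : 0 < q) (h1 : q < 1) (l N e : ℕ) :
    aE q l N (N+e) = ENNReal.ofReal (q^(exl l N)) *
      ∑ M ∈ range (N+1), ENNReal.ofReal (qP q q (N-M))⁻¹ * aE q (l-1) M e := by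
  unfold aE
  rw [← consE.tsum_eq, ENNReal.tsum_prod', ENNReal.tsum_comm]
  simp only [← ENNReal.tsum_mul_left]
  rw [← Summable.tsum_finsetSum (fun _ _ => ENNReal.summable), ← ENNReal.tsum_mul_left]
  refine tsum_congr fun a => ?_
  change ∑' m, (if A1 (consF m a) = N ∧ Wt (consF m a) = N + e then ENNReal.ofReal (wL q l (consF m a)) else 0) = _
  simp only [A1_cons, Wt_cons, wL_cons h0]
  by_cases hN : A1 a ≤ N
  · rw [tsum_eq_single (N - A1 a) (fun m hm => by rw [if_neg]; omega)]
    rw [Finset.sum_eq_single (A1 a)]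
    · have e1 : N - A1 a + A1 a = N := by omega
      rw [e1]
      by_cases he : Wt a = e
      · rw [if_pos ⟨rfl, by omega⟩, if_pos ⟨rfl, he⟩, ENNReal.ofReal_mul (by positivity),
          ENNReal.ofReal_mul (inv_nonneg.2 (qq_pos h0 h1 _).le)]
      · rw [if_neg (by omega), if_neg (by omega)]; simp
    · intro M _ hM
      rw [if_neg (by tauto), mul_zero]
    · intro h; exact absurd (Finset.mem_range.2 (by omega)) h
  · rw [Finset.sum_eq_zero, mul_zero, ENNReal.tsum_eq_zero]
    · intro m; rw [if_neg]; omega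
    · intro M hM
      have : M < N+1 := Finset.mem_range.1 hM
      rw [if_neg (by omega), mul_zero]

lemma aE_lt (q : ℝ) (l : ℕ) {N d : ℕ} (h : d < N) : aE q l N d = 0 := by
  unfold aE
  rw [ENNReal.tsum_eq_zero]
  intro a
  have := A1_le_Wt a
  rw [if_neg]; omega

lemma aE_zero (q : ℝ) (l d : ℕ) : aE q l 0 d = if d = 0 then 1 else 0 := by
  unfold aE
  rw [tsum_eq_single 0]
  · simp [A1, Wt, wL, QQ, PP, wA, eq_comm]
  · intro a ha
    rw [if_neg]
    intro h; exact ha (A1_eq_zero h.1)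

lemma alS_rec_u {q : ℝ} (h0 : 0 < q) (h1 : q < 1) (l N e : ℕ) :
    alS q l N (N+e) = q^(exl l N) * ∑ M ∈ range (N+1), (qP q q (N-M))⁻¹ * alS q (l-1) M e := by
  rcases l with _ | l
  · exact alS_rec0 h0 h1 N e
  · exact alS_rec h0 h1 l N e

lemma aE_eq {q : ℝ} (h0 : 0 < q) (h1 : q < 1) (d : ℕ) :
    ∀ l N, 0 ≤ alS q l N d ∧ aE q l N d = ENNReal.ofReal (alS q l N d) := by
  induction d using Nat.strong_induction_on with
  | _ d ih =>
    intro l N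
    rcases Nat.eq_zero_or_pos N with rfl | hN
    · rw [alS_zero, aE_zero]; split_ifs <;> simp
    · rcases lt_or_ge d N with h | h
      · rw [aE_lt q l h, alS, if_neg (by omega)]; simp
      · obtain ⟨e, rfl⟩ := Nat.exists_eq_add_of_le h
        have ih := ih e (by omega) (l-1)
        have hp : ∀ M, 0 ≤ (qP q q (N-M))⁻¹ := fun M => inv_nonneg.2 (qq_pos h0 h1 _).le
        rw [aE_rec h0 h1, alS_rec_u h0 h1]
        refine ⟨mul_nonneg (by positivity) (Finset.sum_nonneg fun M _ => mul_nonneg (hp M) (ih M).1), ?_⟩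
        rw [ENNReal.ofReal_mul (by positivity), ENNReal.ofReal_sum_of_nonneg (fun M _ => mul_nonneg (hp M) (ih M).1)]
        congr 1
        refine Finset.sum_congr rfl fun M _ => ?_
        rw [ENNReal.ofReal_mul (hp M), (ih M).2]

/-- regrouping -/
lemma regroup {A B : Type*} (f : A → B) (G : B → ℝ≥0∞) (w : A → ℝ≥0∞) [DecidableEq B] :
    ∑' a, G (f a) * w a = ∑' b, G b * ∑' a, (if f a = b then w a else 0) := by
  simp only [← ENNReal.tsum_mul_left]
  rw [ENNReal.tsum_comm]
  refine tsum_congr fun a => ?_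
  rw [tsum_eq_single (f a)]
  · simp
  · intro b hb; rw [if_neg (Ne.symm hb), mul_zero]

def bE (q : ℝ) (j : ℕ) : ℝ≥0∞ := ∑' a : ℕ →₀ ℕ, if Wt a = j then ENNReal.ofReal (wL q 0 a) else 0

lemma bE_eq {q : ℝ} (h0 : 0 < q) (h1 : q < 1) (j : ℕ) :
    bE q j = ENNReal.ofReal (q^j * (qP q q j)⁻¹) := by
  rw [← alS_tot h0 h1, ENNReal.ofReal_sum_of_nonneg (fun M _ => (aE_eq h0 h1 j 0 M).1)]
  simp only [← (aE_eq h0 h1 j 0 _).2, aE]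
  rw [← Summable.tsum_finsetSum (fun _ _ => ENNReal.summable), bE]
  refine tsum_congr fun a => ?_
  by_cases h : Wt a = j
  · have := A1_le_Wt a
    rw [Finset.sum_eq_single (A1 a)]
    · simp [h]
    · intro M _ hM; rw [if_neg (by tauto)]
    · intro h; exact absurd (Finset.mem_range.2 (by omega)) h
  · simp [h]
end

noncomputable section
open Finset

def gS (q : ℝ) : ℕ → ℕ → ℝ
  | _, 0 => 1
  | 0, _+1 => 0
  | N+1, s+1 => gS q N (s+1) + (q^N)⁻¹ * gS q N s

lemma gS_zero (q : ℝ) (N : ℕ) : gS q N 0 = 1 := by cases N <;> simp [gS]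

lemma gS_nonneg {q : ℝ} (h0 : 0 < q) (N s : ℕ) : 0 ≤ gS q N s := by
  induction N generalizing s with
  | zero => cases s <;> simp [gS]
  | succ N ih =>
    cases s with
    | zero => simp [gS]
    | succ s => rw [gS]; have := ih s; have := ih (s+1); positivity

lemma gS_gt (q : ℝ) {N s : ℕ} (h : N < s) : gS q N s = 0 := by
  induction N generalizing s with
  | zero => obtain ⟨s, rfl⟩ : ∃ t, s = t+1 := ⟨s-1, by omega⟩; simp [gS]
  | succ N ih =>
    obtain ⟨s, rfl⟩ : ∃ t, s = t+1 := ⟨s-1, by omega⟩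
    rw [gS, ih (by omega), ih (by omega)]; simp

def en (q : ℝ) (n N : ℕ) : ℝ := q^((n+1).choose 2) * (q^(n*N))⁻¹ * (qP q q n)⁻¹

lemma ch2_succ (s : ℕ) : (s+1).choose 2 = s.choose 2 + s := by
  rw [Nat.choose_succ_succ' s 1]; simp [add_comm]

lemma en_nonneg {q : ℝ} (h0 : 0 < q) (h1 : q < 1) (n N : ℕ) : 0 ≤ en q n N := by
  have := qq_pos h0 h1 n
  unfold en; positivity

lemma en_rec {q : ℝ} (h0 : 0 < q) (h1 : q < 1) (n N : ℕ) :
    en q (n+1) (N+1) = en q (n+1) N + (q^N)⁻¹ * en q n N := by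
  unfold en
  rw [qq_succ, ch2_succ (n+1)]
  have := qq_ne h0 h1 n; have := one_sub_ne h0 h1 n
  have e : (n+1)*(N+1) = n*N + n + N + 1 := by ring
  have e' : (n+1)*N = n*N + N := by ring
  rw [e, e']
  simp only [pow_add]
  simp only [pow_add, pow_one] at this
  field_simp
  ring

lemma en_split {q : ℝ} (h0 : 0 < q) (h1 : q < 1) (n N : ℕ) :
    en q n N = ∑ x ∈ antidiagonal n, en q x.1 0 * gS q N x.2 := by
  induction N generalizing n with
  | zero =>
    rcases n with _ | n
    · simp [gS]
    · rw [Finset.Nat.sum_antidiagonal_succ']; simp [gS]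
  | succ N ih =>
    rcases n with _ | n
    · simp [gS, en]
    · rw [en_rec h0 h1, ih, ih, Finset.Nat.sum_antidiagonal_succ', Finset.Nat.sum_antidiagonal_succ', mul_sum]
      simp only [gS, gS_zero, mul_add, sum_add_distrib]
      rw [add_assoc]
      congr 2
      exact Finset.sum_congr rfl fun x _ => by ring

open PowerSeries in
lemma gS_coeff {q : ℝ} (h0 : 0 < q) (h1 : q < 1) (N : ℕ) : ∀ t s, t + s = N →
    coeff t (rP (algebraMap ℝ (PowerSeries ℝ) q) (-X) N) = q^(N.choose 2) * gS q N s := by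
  induction N with
  | zero =>
    intro t s h
    obtain ⟨rfl, rfl⟩ : t = 0 ∧ s = 0 := by omega
    simp [rP_zero, gS]
  | succ N ih =>
    intro t s h
    rw [rP_succ, show rP (algebraMap ℝ (PowerSeries ℝ) q) (-X) N * (1 - -X * (algebraMap ℝ _ q)^N)
      = rP (algebraMap ℝ (PowerSeries ℝ) q) (-X) N + PowerSeries.C (q^N) * (X * rP (algebraMap ℝ (PowerSeries ℝ) q) (-X) N) by
        simp only [am_eq, map_pow]; ring]
    rw [map_add, coeff_C_mul, ch2_succ, pow_add]
    have hA : coeff t (rP (algebraMap ℝ (PowerSeries ℝ) q) (-X) N) =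
        q^(N.choose 2) * (if s = 0 then 0 else gS q N (s-1)) := by
      split_ifs with hs
      · rw [coeff_rP h0 h1, gb_gt (by omega)]; simp
      · exact ih _ _ (by omega)
    have hB : coeff t (X * rP (algebraMap ℝ (PowerSeries ℝ) q) (-X) N) =
        q^(N.choose 2) * gS q N s := by
      rcases t with _ | t
      · rw [gS_gt q (by omega)]; simp
      · rw [coeff_succ_X_mul]; exact ih _ _ (by omega)
    rw [hA, hB]
    have : q^N ≠ 0 := by positivity
    rcases s with _ | s
    · simp [gS_zero]; ring
    · simp only [gS, Nat.add_eq_zero_iff, one_ne_zero, and_false, if_false, Nat.add_sub_cancel]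
      field_simp; ring

open PowerSeries in
lemma coeff_mul_fin (f g : PowerSeries ℝ) (N m : ℕ) (hf : ∀ t, N < t → coeff t f = 0) :
    coeff m (f * g) = ∑ t ∈ range (N+1), if t ≤ m then coeff t f * coeff (m-t) g else 0 := by
  rw [coeff_mul, Finset.Nat.sum_antidiagonal_eq_sum_range_succ_mk]
  have : ∑ t ∈ range m.succ, coeff t f * coeff (m-t) g
      = ∑ t ∈ range (m+1), if t ≤ m then coeff t f * coeff (m-t) g else 0 :=
    Finset.sum_congr rfl fun t ht => by
      rw [if_pos]; simpa [Nat.lt_succ_iff] using ht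
  simp only [this]
  rw [Finset.sum_subset (range_subset_range.2 (show m+1 ≤ m+N+1 by omega)),
    Finset.sum_subset (range_subset_range.2 (show N+1 ≤ m+N+1 by omega))]
  · intro t _ ht
    rw [hf t (by simpa using ht)]; simp
  · intro t _ ht
    rw [if_neg (by simpa [Nat.lt_succ_iff] using ht)]

open PowerSeries in
lemma Fs_odd {q : ℝ} (l N c : ℕ) (h : ¬ Even c) : coeff c (Fs q l N) = 0 := by
  rw [Fs, show X^(2*l) * algebraMap ℝ (PowerSeries ℝ) (1 - q^N) * II q (N+1) = PowerSeries.C (1 - q^N) * (X^(2*l) * II q (N+1)) by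
    rw [am_eq]; ring, map_sub, coeff_C_mul, coeff_X_pow_mul']
  simp only [II, coeff_mk]
  rw [if_neg h]
  split_ifs with h2 h3
  · exfalso; apply h
    rw [Nat.even_sub h2] at h3; simpa using h3
  · simp
  · simp

open ENNReal

def ind (P : Prop) [Decidable P] : ℝ≥0∞ := if P then 1 else 0

def kapE (q : ℝ) (l : ℕ) (c : ℤ) : ℝ≥0∞ :=
  ∑' N : ℕ, ∑' d : ℕ, ∑' s : ℕ, ind (2*(d:ℤ) - s = c) *
    (ENNReal.ofReal (gS q N s) * ENNReal.ofReal (alS q l N d))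

lemma alS_nonneg {q : ℝ} (h0 : 0 < q) (h1 : q < 1) (l N d : ℕ) : 0 ≤ alS q l N d :=
  (aE_eq h0 h1 d l N).1

lemma kapE_neg {q : ℝ} (l : ℕ) {c : ℤ} (hc : c < 0) : kapE q l c = 0 := by
  unfold kapE
  simp only [ENNReal.tsum_eq_zero]
  intro N d s
  by_cases h1 : N < s
  · simp [gS_gt q h1]
  by_cases h2 : N ≤ d
  · have : ¬ (2*(d:ℤ) - s = c) := by omega
    simp [ind, this]
  · simp [alS, h2]

end

noncomputable section
open Finset
open ENNReal

lemma choose2_add (N : ℕ) : N.choose 2 + N.choose 2 = N*(N-1) := by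
  induction N with
  | zero => rfl
  | succ n ih =>
    rw [ch2_succ]
    rcases n with _ | n
    · rfl
    · simp at ih ⊢; nlinarith

open PowerSeries in
lemma kap_real {q : ℝ} (h0 : 0 < q) (h1 : q < 1) (l N c : ℕ) :
  q^(N.choose 2) * (qP q q N)⁻¹ *
      coeff c (X^N * (rP (algebraMap ℝ (PowerSeries ℝ) q) (-X) N * Fs q l N))
      = ∑ t ∈ range (N+1), (if Even (c + t) then gS q N t * alS q l N ((c+t)/2) else 0) := by
  rw [coeff_X_pow_mul', coeff_mul_fin _ _ N _ (fun t ht => by rw [coeff_rP h0 h1, gb_gt ht, zero_mul])]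
  split_ifs with hN
  · rw [← Finset.sum_range_reflect, mul_sum]
    refine Finset.sum_congr rfl fun t ht => ?_
    have ht : t ≤ N := by simpa [Nat.lt_succ_iff] using ht
    rw [show N + 1 - 1 - t = N - t by omega, gS_coeff h0 h1 N (N-t) t (by omega)]
    by_cases he : Even (c+t)
    · rw [if_pos he]
      obtain ⟨d, hd⟩ := he
      rw [show (c+t)/2 = d by omega, alS]
      by_cases h2 : N ≤ d
      · rw [if_pos h2, if_pos (by omega), show c - N - (N-t) = 2*(d-N) by omega, ← choose2_add, pow_add]
        ring
      · rw [if_neg h2, if_neg (by omega)]; simp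
    · rw [if_neg he]
      split_ifs with h3
      · rw [Fs_odd]
        · simp
        · intro h; apply he
          rw [Nat.even_iff] at h ⊢; omega
      · simp
  · rw [mul_zero]
    symm
    apply Finset.sum_eq_zero
    intro t ht
    have ht : t ≤ N := by simpa [Nat.lt_succ_iff] using ht
    split_ifs
    · rw [alS, if_neg (by omega), mul_zero]
    · rfl

open PowerSeries in
lemma kap_term {q : ℝ} (h0 : 0 < q) (h1 : q < 1) (l N c : ℕ) :
    ∑' d : ℕ, ∑' s : ℕ, ind (2*(d:ℤ) - s = (c:ℤ)) *
      (ENNReal.ofReal (gS q N s) * ENNReal.ofReal (alS q l N d))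
    = ENNReal.ofReal (q^(N.choose 2) * (qP q q N)⁻¹ *
      coeff c (X^N * (rP (algebraMap ℝ (PowerSeries ℝ) q) (-X) N * Fs q l N)))
     ∧ 0 ≤ q^(N.choose 2) * (qP q q N)⁻¹ *
      coeff c (X^N * (rP (algebraMap ℝ (PowerSeries ℝ) q) (-X) N * Fs q l N)) := by
  have hnn : ∀ t ∈ range (N+1), 0 ≤ (if Even (c + t) then gS q N t * alS q l N ((c+t)/2) else 0) := by
    intro t _
    split_ifs
    · exact mul_nonneg (gS_nonneg h0 _ _) (alS_nonneg h0 h1 _ _ _)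
    · rfl
  rw [kap_real h0 h1]
  refine ⟨?_, Finset.sum_nonneg hnn⟩
  rw [ENNReal.ofReal_sum_of_nonneg hnn, ENNReal.tsum_comm, tsum_eq_sum (s := range (N+1))]
  · refine Finset.sum_congr rfl fun s _ => ?_
    split_ifs with he
    · obtain ⟨d, hd⟩ := he
      rw [show (c+s)/2 = d by omega, tsum_eq_single d]
      · rw [ind, if_pos (by omega), one_mul, ENNReal.ofReal_mul (gS_nonneg h0 _ _)]
      · intro d' hd'
        rw [ind, if_neg (by omega), zero_mul]
    · rw [ENNReal.ofReal_zero, ENNReal.tsum_eq_zero]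
      intro d
      rw [ind, if_neg, zero_mul]
      intro h; apply he
      exact ⟨d, by omega⟩
  · intro s hs
    rw [ENNReal.tsum_eq_zero]
    intro d
    rw [gS_gt q (by simpa using hs)]; simp

open PowerSeries in
lemma kapE_nat {q : ℝ} (h0 : 0 < q) (h1 : q < 1) (l c : ℕ) :
    kapE q l (c:ℤ) = ENNReal.ofReal (vv q c - (if 2*l+1 ≤ c then vv q (c - (2*l+1)) else 0)) ∧
      0 ≤ vv q c - (if 2*l+1 ≤ c then vv q (c - (2*l+1)) else 0) := by
  rw [← K_lim h0 h1 l c]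
  refine ⟨?_, Finset.sum_nonneg fun N _ => (kap_term h0 h1 l N c).2⟩
  rw [ENNReal.ofReal_sum_of_nonneg fun N _ => (kap_term h0 h1 l N c).2]
  unfold kapE
  rw [tsum_eq_sum (s := range (c+1))]
  · exact Finset.sum_congr rfl fun N _ => (kap_term h0 h1 l N c).1
  · intro N hN
    rw [(kap_term h0 h1 l N c).1, coeff_X_pow_mul', if_neg (by simpa using hN)]
    simp

def ep (q : ℝ) (s : ℕ) : ℝ := q^(s.choose 2) * (qP q q s)⁻¹

lemma ep_nonneg {q : ℝ} (h0 : 0 < q) (h1 : q < 1) (s : ℕ) : 0 ≤ ep q s := by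
  have := qq_pos h0 h1 s
  unfold ep; positivity

def vE (q : ℝ) (c : ℤ) : ℝ≥0∞ :=
  ∑' s : ℕ, ∑' i : ℕ, ind ((s:ℤ) + 2*i = c) * (ENNReal.ofReal (ep q s) * ENNReal.ofReal (qP q q i)⁻¹)

lemma vE_neg {q : ℝ} {c : ℤ} (hc : c < 0) : vE q c = 0 := by
  unfold vE
  simp only [ENNReal.tsum_eq_zero]
  intro s i
  rw [ind, if_neg (by omega), zero_mul]

lemma vE_nat {q : ℝ} (h0 : 0 < q) (h1 : q < 1) (c : ℕ) :
    vE q (c:ℤ) = ENNReal.ofReal (vv q c) ∧ 0 ≤ vv q c := by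
  have hp : ∀ i, 0 ≤ (qP q q i)⁻¹ := fun i => (inv_pos.2 (qq_pos h0 h1 i)).le
  have hnn : ∀ p ∈ antidiagonal c, 0 ≤ ((qP q q p.1)⁻¹*q^(p.1.choose 2)) * (if Even p.2 then (qP q q (p.2/2))⁻¹ else 0) := by
    intro p _
    have := hp p.1
    have := hp (p.2/2)
    split_ifs <;> positivity
  have hv : vv q c = ∑ p ∈ antidiagonal c, ((qP q q p.1)⁻¹*q^(p.1.choose 2)) * (if Even p.2 then (qP q q (p.2/2))⁻¹ else 0) := rfl
  rw [hv]
  refine ⟨?_, Finset.sum_nonneg hnn⟩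
  rw [ENNReal.ofReal_sum_of_nonneg hnn, Finset.Nat.sum_antidiagonal_eq_sum_range_succ_mk]
  unfold vE
  rw [tsum_eq_sum (s := range c.succ)]
  · refine Finset.sum_congr rfl fun s hs => ?_
    have hs : s ≤ c := by simpa [Nat.lt_succ_iff] using hs
    dsimp only
    split_ifs with he
    · obtain ⟨i, hi⟩ := he
      rw [show (c-s)/2 = i by omega, tsum_eq_single i]
      · rw [ind, if_pos (by omega), one_mul, ← ENNReal.ofReal_mul (ep_nonneg h0 h1 _), ep]
        congr 1; ring
      · intro j hj
        rw [ind, if_neg (by omega), zero_mul]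
    · rw [mul_zero, ENNReal.ofReal_zero, ENNReal.tsum_eq_zero]
      intro i
      rw [ind, if_neg, zero_mul]
      intro h; exact he ⟨i, by omega⟩
  · intro s hs
    have hs : c < s := by simpa [Nat.lt_succ_iff] using hs
    rw [ENNReal.tsum_eq_zero]
    intro i
    rw [ind, if_neg (by omega), zero_mul]

lemma kap_v {q : ℝ} (h0 : 0 < q) (h1 : q < 1) (l : ℕ) (c : ℤ) :
    kapE q l c + vE q (c - (2*l+1)) = vE q c := by
  rcases lt_or_ge c 0 with hc | hc
  · rw [kapE_neg l hc, vE_neg hc, vE_neg (by omega), add_zero]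
  · lift c to ℕ using hc
    rw [(kapE_nat h0 h1 l c).1, (vE_nat h0 h1 c).1]
    have h2 := (kapE_nat h0 h1 l c).2
    split_ifs at h2 ⊢ with h
    · rw [show (c:ℤ) - (2*l+1) = ((c - (2*l+1) : ℕ) : ℤ) by omega, (vE_nat h0 h1 _).1,
        ← ENNReal.ofReal_add h2 (vE_nat h0 h1 _).2]
      congr 1; ring
    · rw [vE_neg (by omega)]; simp

/- the limit object in ENNReal -/
def LLE (q : ℝ) (l : ℕ) (r : ℤ) : ℝ≥0∞ :=
  ∑' n : ℕ, ∑' a : ℕ →₀ ℕ, ∑' b : ℕ →₀ ℕ, ind ((n:ℤ) - r = 2*((Wt a:ℤ) - Wt b)) *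
    (ENNReal.ofReal (en q n (A1 a)) * (ENNReal.ofReal (wL q l a) * ENNReal.ofReal (wL q 0 b)))

lemma LLE_b {q : ℝ} (h0 : 0 < q) (h1 : q < 1) (l : ℕ) (r : ℤ) :
    LLE q l r = ∑' n : ℕ, ∑' a : ℕ →₀ ℕ, ∑' j : ℕ, ind ((n:ℤ) - r = 2*((Wt a:ℤ) - j)) *
    (ENNReal.ofReal (en q n (A1 a)) * (ENNReal.ofReal (wL q l a) * bE q j)) := by
  unfold LLE
  refine tsum_congr fun n => tsum_congr fun a => ?_
  have := regroup (A := ℕ →₀ ℕ) Wt (fun j : ℕ => ind ((n:ℤ) - r = 2*((Wt a:ℤ) - j)) *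
    (ENNReal.ofReal (en q n (A1 a)) * (ENNReal.ofReal (wL q l a)))) (fun b => ENNReal.ofReal (wL q 0 b))
  simp only [mul_assoc] at this
  rw [this]
  rfl

lemma LLE_a {q : ℝ} (h0 : 0 < q) (h1 : q < 1) (l : ℕ) (r : ℤ) :
    LLE q l r = ∑' j : ℕ, ∑' n : ℕ, ∑' N : ℕ, ∑' d : ℕ, ind ((n:ℤ) - r = 2*((d:ℤ) - j)) *
    (ENNReal.ofReal (en q n N) * (ENNReal.ofReal (alS q l N d) * bE q j)) := by
  rw [LLE_b h0 h1]
  have e1 : ∀ n : ℕ, (∑' a : ℕ →₀ ℕ, ∑' j : ℕ, ind ((n:ℤ) - r = 2*((Wt a:ℤ) - j)) *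
    (ENNReal.ofReal (en q n (A1 a)) * (ENNReal.ofReal (wL q l a) * bE q j)))
     = ∑' j : ℕ, ∑' a : ℕ →₀ ℕ, ind ((n:ℤ) - r = 2*((Wt a:ℤ) - j)) *
    (ENNReal.ofReal (en q n (A1 a)) * (ENNReal.ofReal (wL q l a) * bE q j)) := fun n => ENNReal.tsum_comm
  simp only [e1]
  rw [ENNReal.tsum_comm]
  refine tsum_congr fun j => tsum_congr fun n => ?_
  have := regroup (A := ℕ →₀ ℕ) (fun a => (A1 a, Wt a)) (fun x : ℕ × ℕ => ind ((n:ℤ) - r = 2*((x.2:ℤ) - j)) *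
    (ENNReal.ofReal (en q n x.1) * bE q j)) (fun a => ENNReal.ofReal (wL q l a))
  calc _ = ∑' a : ℕ →₀ ℕ, ind ((n:ℤ) - r = 2*((Wt a:ℤ) - j)) *
    (ENNReal.ofReal (en q n (A1 a)) * bE q j) * ENNReal.ofReal (wL q l a) := 
        tsum_congr fun a => by ring
    _ = _ := this
    _ = _ := by
      rw [ENNReal.tsum_prod']
      refine tsum_congr fun N => tsum_congr fun d => ?_
      rw [← (aE_eq h0 h1 d l N).2, aE]
      simp only [Prod.mk.injEq]
      ring

lemma en_splitE {q : ℝ} (h0 : 0 < q) (h1 : q < 1) (N : ℕ) (G : ℕ → ℝ≥0∞) :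
    ∑' n, G n * ENNReal.ofReal (en q n N) =
      ∑' p, ∑' s, G (p+s) * (ENNReal.ofReal (en q p 0) * ENNReal.ofReal (gS q N s)) := by
  rw [← ENNReal.tsum_prod (f := fun p s => G (p+s) * (ENNReal.ofReal (en q p 0) * ENNReal.ofReal (gS q N s)))]
  rw [regroup (fun x : ℕ × ℕ => x.1 + x.2) G]
  refine tsum_congr fun n => ?_
  congr 1
  rw [en_split h0 h1, ENNReal.ofReal_sum_of_nonneg
    (fun x _ => mul_nonneg (en_nonneg h0 h1 _ _) (gS_nonneg h0 _ _)), tsum_eq_sum (s := antidiagonal n)]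
  · refine Finset.sum_congr rfl fun x hx => ?_
    rw [if_pos (by simpa using hx), ENNReal.ofReal_mul (en_nonneg h0 h1 _ _)]
  · intro x hx
    rw [if_neg (by simpa using hx)]

lemma LLE_k {q : ℝ} (h0 : 0 < q) (h1 : q < 1) (l : ℕ) (r : ℤ) :
    LLE q l r = ∑' p : ℕ, ∑' j : ℕ, 
    (ENNReal.ofReal (en q p 0) * bE q j) * kapE q l (2*j + p - r) := by
  rw [LLE_a h0 h1, ENNReal.tsum_comm (f := fun p j : ℕ => (ENNReal.ofReal (en q p 0) * bE q j) * kapE q l (2*j + p - r))]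
  refine tsum_congr fun j => ?_
  unfold kapE
  simp only [← ENNReal.tsum_mul_left]
  rw [ENNReal.tsum_comm]
  refine Eq.trans ?_ ENNReal.tsum_comm
  refine tsum_congr fun N => ?_
  rw [ENNReal.tsum_comm]
  refine Eq.trans ?_ ENNReal.tsum_comm
  refine tsum_congr fun d => ?_
  have := en_splitE h0 h1 N (fun n => ind ((n:ℤ) - r = 2*((d:ℤ) - j)) * (ENNReal.ofReal (alS q l N d) * bE q j))
  calc _ = ∑' n : ℕ, ind ((n:ℤ) - r = 2*((d:ℤ) - j)) * (ENNReal.ofReal (alS q l N d) * bE q j) * ENNReal.ofReal (en q n N) := tsum_congr fun n => by ring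
    _ = _ := this
    _ = _ := by
      refine tsum_congr fun p => tsum_congr fun s => ?_
      have e : ((((p+s:ℕ):ℤ) - r = 2*((d:ℤ) - j))) ↔ (2*(d:ℤ) - s = 2*j+p-r) := by
        push_cast; constructor <;> intro h <;> linarith
      simp only [ind, e]
      ring

def VE (q : ℝ) (r : ℤ) : ℝ≥0∞ :=
  ∑' p : ℕ, ∑' j : ℕ, (ENNReal.ofReal (en q p 0) * bE q j) * vE q (2*j + p - r)

lemma LLE_VE {q : ℝ} (h0 : 0 < q) (h1 : q < 1) (l : ℕ) (r : ℤ) :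
    LLE q l r + VE q (r + 2*l + 1) = VE q r := by
  rw [LLE_k h0 h1, VE, ← ENNReal.tsum_add]
  refine tsum_congr fun p => ?_
  rw [← ENNReal.tsum_add]
  refine tsum_congr fun j => ?_
  rw [← mul_add, show (2*(j:ℤ) + p - (r+2*l+1)) = (2*j+p-r) - (2*l+1) by ring, kap_v h0 h1]

end

noncomputable section
open Finset
open ENNReal

lemma rP_qq {q : ℝ} (h0 : 0 < q) (h1 : q < 1) (m N : ℕ) :
    qP q q m * rP q (q^(m+1)) N = qP q q (m+N) := by
  induction N with
  | zero => simp [rP_zero]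
  | succ N ih =>
    rw [rP_succ, ← mul_assoc, ih, ← add_assoc, qq_succ]
    congr 2
    rw [← pow_add]; congr 1; ring

lemma cauchy_fin {q : ℝ} (h0 : 0 < q) (h1 : q < 1) (m N : ℕ) :
    ∑ M ∈ range (N+1), q^(M*M+m*M) * gb q N M * (qP q q (m+M))⁻¹ = (qP q q (m+N))⁻¹ := by
  have hm := qq_ne h0 h1 m
  have := durfee (R := ℝ) h0 h1 N (q^(m+1)) (fun N => qP q q m * (qP q q (m+N))⁻¹) (fun N => by
    rw [mul_right_comm, Algebra.algebraMap_self_apply, rP_qq h0 h1, mul_inv_cancel₀ (qq_ne h0 h1 _)])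
  apply mul_left_cancel₀ hm
  rw [← this, mul_sum]
  refine Finset.sum_congr rfl fun M _ => ?_
  rw [Algebra.algebraMap_self_apply, ← pow_mul, ← mul_assoc (_ ^ _) (_ ^ _), ← pow_add]
  have : (m+1)*M + M*(M-1) = M*M+m*M := by
    rcases M with _ | M
    · simp
    · simp; ring
  rw [this]; ring

lemma cauchy_sum {q : ℝ} (h0 : 0 < q) (h1 : q < 1) (m : ℕ) :
    HasSum (fun M : ℕ => q^(M*M+m*M) * (qP q q M)⁻¹ * (qP q q (m+M))⁻¹) (qPInf q q)⁻¹ := by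
  set B := (qPInf q q)⁻¹ with hB
  have hBp : 0 < B := inv_pos.2 (qInf_pos h0 h1)
  have hbs : Summable (fun M : ℕ => q^M * B * B) :=
    ((summable_geometric_of_lt_one h0.le h1).mul_right B).mul_right B
  have hi : ∀ n, 0 < (qP q q n)⁻¹ := fun n => inv_pos.2 (qq_pos h0 h1 n)
  have hbd : ∀ M (y : ℝ), 0 ≤ y → y ≤ (qP q q M)⁻¹ → 
      ‖q^(M*M+m*M) * y * (qP q q (m+M))⁻¹‖ ≤ q^M * B * B := by
    intro M y hy hy'
    have := hi (m+M)
    rw [Real.norm_of_nonneg (by positivity)]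
    have h3 : q^(M*M+m*M) ≤ q^M := pow_le_pow_of_le_one h0.le h1.le (by nlinarith [Nat.le_mul_self M])
    have h4 := qq_inv_le h0 h1 (m+M)
    have h5 := hy'.trans (qq_inv_le h0 h1 M)
    gcongr
  have hsum : Summable (fun M : ℕ => q^(M*M+m*M) * (qP q q M)⁻¹ * (qP q q (m+M))⁻¹) :=
    Summable.of_norm_bounded hbs fun M => hbd M _ (hi M).le le_rfl
  have ht := tendsto_tsum_of_dominated_convergence (𝓕 := Filter.atTop)
    (f := fun N M : ℕ => q^(M*M+m*M) * gb q N M * (qP q q (m+M))⁻¹)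
    (g := fun M : ℕ => q^(M*M+m*M) * (qP q q M)⁻¹ * (qP q q (m+M))⁻¹) hbs
    (fun M => (tendsto_const_nhds.mul (gb_tendsto h0 h1 M)).mul tendsto_const_nhds)
    (Filter.Eventually.of_forall fun N M => hbd M _ (gb_nonneg h0 h1 N M) (gb_le h0 h1 N M))
  have e : ∀ N, ∑' M : ℕ, q^(M*M+m*M) * gb q N M * (qP q q (m+M))⁻¹ = (qP q q (m+N))⁻¹ := by
    intro N
    rw [← cauchy_fin h0 h1 m N, tsum_eq_sum]
    intro M hM
    rw [gb_gt (by simpa using hM)]; simp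
  simp only [e] at ht
  have ht2 : Filter.Tendsto (fun N => (qP q q (m+N))⁻¹) Filter.atTop (nhds B) := by
    refine Filter.Tendsto.inv₀ ?_ (qInf_ne h0 h1)
    have := (Filter.tendsto_add_atTop_iff_nat m).2 (qq_tendsto h0 h1)
    simpa only [add_comm m] using this
  rw [← tendsto_nhds_unique ht ht2]
  exact hsum.hasSum

lemma cauchyE {q : ℝ} (h0 : 0 < q) (h1 : q < 1) (m : ℕ) :
    ∑' M : ℕ, ENNReal.ofReal (q^(M*M+m*M) * (qP q q M)⁻¹ * (qP q q (m+M))⁻¹) = ENNReal.ofReal (qPInf q q)⁻¹ := by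
  have hi : ∀ n, 0 < (qP q q n)⁻¹ := fun n => inv_pos.2 (qq_pos h0 h1 n)
  rw [← (cauchy_sum h0 h1 m).tsum_eq, ENNReal.ofReal_tsum_of_nonneg _ (cauchy_sum h0 h1 m).summable]
  intro M
  have := hi M; have := hi (m+M); positivity

lemma choose2_dbl (n : ℕ) : 2 * (n.choose 2 : ℤ) = n * (n-1) := by
  induction n with
  | zero => simp
  | succ n ih => rw [ch2_succ]; push_cast; linarith

lemma ch2_dbl (n : ℤ) : 2 * ch2 n = n * (n-1) := by
  unfold ch2
  exact Int.mul_ediv_cancel' (by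
    have := Int.even_mul_pred_self n
    exact this.two_dvd)

lemma ch2_nonneg (n : ℤ) : 0 ≤ ch2 n := by
  have := ch2_dbl n
  rcases le_or_gt n 0 with h | h <;> nlinarith

def JE (q : ℝ) (n : ℤ) : ℝ≥0∞ :=
  ∑' p : ℕ, ∑' s : ℕ, ind ((s:ℤ) - p = n) * (ENNReal.ofReal (en q p 0) * ENNReal.ofReal (ep q s))

lemma JE_eq {q : ℝ} (h0 : 0 < q) (h1 : q < 1) (n : ℤ) :
    JE q n = ENNReal.ofReal (q^(ch2 n)) * ENNReal.ofReal (qPInf q q)⁻¹ := by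
  have hi : ∀ n, 0 < (qP q q n)⁻¹ := fun n => inv_pos.2 (qq_pos h0 h1 n)
  unfold JE
  rcases le_or_gt 0 n with hn | hn
  · lift n to ℕ using hn
    rw [← cauchyE h0 h1 n, ← ENNReal.tsum_mul_left]
    refine tsum_congr fun p => ?_
    rw [tsum_eq_single (n+p)]
    · rw [ind, if_pos (by push_cast; ring), one_mul, ← ENNReal.ofReal_mul (en_nonneg h0 h1 _ _),
        ← ENNReal.ofReal_mul (by positivity)]
      congr 1
      unfold en ep
      have e : (p+1).choose 2 + (n+p).choose 2 = n.choose 2 + (p*p+n*p) := by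
        have h1 := choose2_dbl (p+1)
        have h2 := choose2_dbl (n+p)
        have h3 := choose2_dbl n
        push_cast at h1 h2 h3
        zify; nlinarith
      have e2 : ch2 n = ((n.choose 2 : ℕ) : ℤ) := by
        have := choose2_dbl n; have := ch2_dbl n; omega
      rw [e2, zpow_natCast]
      calc _ = q^((p+1).choose 2 + (n+p).choose 2) * (qP q q p)⁻¹ * (qP q q (n+p))⁻¹ := by
            rw [pow_add]; simp; ring
        _ = _ := by rw [e, pow_add]; ring
    · intro s hs
      rw [ind, if_neg (by omega), zero_mul]
  · obtain ⟨m, rfl⟩ : ∃ m : ℕ, n = -(m:ℤ) := ⟨n.natAbs, by omega⟩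
    rw [← cauchyE h0 h1 m, ← ENNReal.tsum_mul_left, ENNReal.tsum_comm]
    refine tsum_congr fun s => ?_
    rw [tsum_eq_single (m+s)]
    · rw [ind, if_pos (by push_cast; ring), one_mul, ← ENNReal.ofReal_mul (en_nonneg h0 h1 _ _),
        ← ENNReal.ofReal_mul (by positivity)]
      congr 1
      unfold en ep
      have e : (m+s+1).choose 2 + s.choose 2 = (m+1).choose 2 + (s*s+m*s) := by
        have h1 := choose2_dbl (m+s+1)
        have h2 := choose2_dbl s
        have h3 := choose2_dbl (m+1)
        push_cast at h1 h2 h3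
        zify; nlinarith
      have e2 : ch2 (-(m:ℤ)) = (((m+1).choose 2 : ℕ) : ℤ) := by
        have h1 := choose2_dbl (m+1); have h2 := ch2_dbl (-(m:ℤ))
        push_cast at h1
        nlinarith
      rw [e2, zpow_natCast]
      calc _ = q^((m+s+1).choose 2 + s.choose 2) * (qP q q s)⁻¹ * (qP q q (m+s))⁻¹ := by
            rw [pow_add]; simp; ring
        _ = _ := by rw [e, pow_add]; ring
    · intro p hp
      rw [ind, if_neg (by omega), zero_mul]

lemma VE_J {q : ℝ} (h0 : 0 < q) (h1 : q < 1) (r : ℤ) :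
    VE q r = ∑' i : ℕ, ∑' j : ℕ, ENNReal.ofReal ((qPInf q q)⁻¹ * 
      (q^(ch2 (2*(j:ℤ) - 2*(i:ℤ) - r) + (j:ℤ)) * ((qP q q i)⁻¹ * (qP q q j)⁻¹))) := by
  have hi : ∀ n, 0 < (qP q q n)⁻¹ := fun n => inv_pos.2 (qq_pos h0 h1 n)
  have hI := inv_pos.2 (qInf_pos h0 h1)
  have e : ∀ i j : ℕ, ENNReal.ofReal ((qPInf q q)⁻¹ * 
      (q^(ch2 (2*(j:ℤ) - 2*(i:ℤ) - r) + (j:ℤ)) * ((qP q q i)⁻¹ * (qP q q j)⁻¹)))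
      = (bE q j * ENNReal.ofReal (qP q q i)⁻¹) * JE q (2*(j:ℤ) - 2*(i:ℤ) - r) := by
    intro i j
    have := hi i; have := hi j
    rw [JE_eq h0 h1, bE_eq h0 h1, zpow_add₀ h0.ne', zpow_natCast, ← ENNReal.ofReal_mul (by positivity),
      ← ENNReal.ofReal_mul (by positivity), ← ENNReal.ofReal_mul (by positivity)]
    congr 1; ring
  simp only [e]
  unfold VE vE JE
  simp only [← ENNReal.tsum_mul_left]
  rw [ENNReal.tsum_comm]
  refine Eq.trans ?_ ENNReal.tsum_comm
  refine tsum_congr fun j => ?_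
  refine Eq.trans ?_ ENNReal.tsum_comm
  refine tsum_congr fun p => ?_
  refine Eq.trans ?_ ENNReal.tsum_comm
  refine tsum_congr fun s => tsum_congr fun i => ?_
  have e : ((s:ℤ) + 2*i = 2*j+p-r) ↔ ((s:ℤ) - p = 2*j-2*i-r) := by
    constructor <;> intro h <;> linarith
  simp only [ind, e]
  ring

lemma V_summable {q : ℝ} (h0 : 0 < q) (h1 : q < 1) (t : ℤ) :
    Summable (fun ij : ℕ × ℕ => q^(ch2 (2*(ij.2:ℤ) - 2*(ij.1:ℤ) - t) + (ij.2:ℤ)) *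
      ((qP q q ij.1)⁻¹ * (qP q q ij.2)⁻¹)) := by
  have hi : ∀ n, 0 < (qP q q n)⁻¹ := fun n => inv_pos.2 (qq_pos h0 h1 n)
  set B := (qPInf q q)⁻¹ with hB
  have hBp : 0 < B := inv_pos.2 (qInf_pos h0 h1)
  set y := q^((1:ℝ)/2) with hy
  have hy0 : 0 < y := Real.rpow_pos_of_pos h0 _
  have hy1 : y < 1 := Real.rpow_lt_one h0.le h1 (by norm_num)
  set C : ℝ := q^(-(|(t:ℝ)|+1)/4) with hC
  have hCp : 0 < C := Real.rpow_pos_of_pos h0 _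
  have hg := summable_geometric_of_lt_one hy0.le hy1
  have hs : Summable (fun ij : ℕ × ℕ => C * (y^ij.1 * y^ij.2) * (B*B)) :=
    (((hg.mul_of_nonneg hg (fun _ => by positivity) (fun _ => by positivity)).mul_left C).mul_right _)
  refine Summable.of_nonneg_of_le (fun ij => ?_) (fun ij => ?_) hs
  · have := hi ij.1; have := hi ij.2; positivity
  · obtain ⟨i, j⟩ := ij
    dsimp only
    have := hi i; have := hi j
    have h3 := qq_inv_le h0 h1 i; have h4 := qq_inv_le h0 h1 j
    have h5 : q^(ch2 (2*(j:ℤ) - 2*(i:ℤ) - t) + (j:ℤ)) ≤ C * (y^i * y^j) := by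
      rw [hC, hy, ← Real.rpow_natCast, ← Real.rpow_natCast, ← Real.rpow_mul h0.le, ← Real.rpow_mul h0.le,
        ← Real.rpow_add h0, ← Real.rpow_add h0, ← Real.rpow_intCast]
      apply Real.rpow_le_rpow_of_exponent_ge h0 h1.le
      have hn := ch2_nonneg (2*(j:ℤ) - 2*(i:ℤ) - t)
      have hd : -(2*(j:ℤ) - 2*(i:ℤ) - t) - 1 ≤ ch2 (2*(j:ℤ) - 2*(i:ℤ) - t) := by
        have := ch2_dbl (2*(j:ℤ) - 2*(i:ℤ) - t)
        generalize 2*(j:ℤ) - 2*(i:ℤ) - t = n at *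
        nlinarith [sq_nonneg (2*n+1)]
      have hn' : (0:ℝ) ≤ ch2 (2*(j:ℤ) - 2*(i:ℤ) - t) := by exact_mod_cast hn
      have hd' : -(2*(j:ℝ) - 2*(i:ℝ) - t) - 1 ≤ ch2 (2*(j:ℤ) - 2*(i:ℤ) - t) := by exact_mod_cast hd
      push_cast
      have := neg_abs_le (t:ℝ)
      have hj : (0:ℝ) ≤ j := by positivity
      linarith
    gcongr

lemma V_VE {q : ℝ} (h0 : 0 < q) (h1 : q < 1) (t : ℤ) :
    VE q t = ENNReal.ofReal (V q t) ∧ 0 ≤ V q t := by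
  have hi : ∀ n, 0 < (qP q q n)⁻¹ := fun n => inv_pos.2 (qq_pos h0 h1 n)
  have hI := inv_pos.2 (qInf_pos h0 h1)
  have hV : V q t = ∑' ij : ℕ × ℕ, (qPInf q q)⁻¹ * (q^(ch2 (2*(ij.2:ℤ) - 2*(ij.1:ℤ) - t) + (ij.2:ℤ)) *
      ((qP q q ij.1)⁻¹ * (qP q q ij.2)⁻¹)) := by
    rw [tsum_mul_left, V]
    simp only [Real.rpow_intCast]
  have hnn : ∀ ij : ℕ × ℕ, 0 ≤ (qPInf q q)⁻¹ * (q^(ch2 (2*(ij.2:ℤ) - 2*(ij.1:ℤ) - t) + (ij.2:ℤ)) *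
      ((qP q q ij.1)⁻¹ * (qP q q ij.2)⁻¹)) := by
    intro ij
    have := hi ij.1; have := hi ij.2; positivity
  rw [hV]
  refine ⟨?_, tsum_nonneg hnn⟩
  rw [VE_J h0 h1, ENNReal.ofReal_tsum_of_nonneg hnn ((V_summable h0 h1 t).mul_left _), ENNReal.tsum_prod']

lemma LLE_eq {q : ℝ} (h0 : 0 < q) (h1 : q < 1) (l : ℕ) (r : ℤ) :
    (LLE q l r).toReal = V q r - V q (r + 2*l + 1) := by
  have h := LLE_VE h0 h1 l r
  rw [(V_VE h0 h1 _).1, (V_VE h0 h1 _).1] at h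
  have hf : LLE q l r ≠ ⊤ := by
    intro hc; rw [hc] at h; simp at h
  have := congrArg ENNReal.toReal h
  rw [ENNReal.toReal_add hf ENNReal.ofReal_ne_top, ENNReal.toReal_ofReal (V_VE h0 h1 _).2,
    ENNReal.toReal_ofReal (V_VE h0 h1 _).2] at this
  linarith

end

noncomputable section
open Finset
open ENNReal

lemma cons_supp_inv {m : ℕ} {a : ℕ →₀ ℕ} {H : ℕ} (h : (consF m a).support ⊆ range (H+1)) :
    a.support ⊆ range H := by
  intro i hi
  have : i+1 ∈ (consF m a).support := by
    rw [Finsupp.mem_support_iff, consF_succ]; exact Finsupp.mem_support_iff.1 hi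
  have := h this
  simpa using this

lemma cons_surj (a : ℕ →₀ ℕ) : ∃ m a', a = consF m a' := by
  obtain ⟨p, hp⟩ := consE.surjective a
  exact ⟨p.1, p.2, hp.symm⟩

lemma Wt_zero' : Wt 0 = 0 := by simp [Wt]
lemma QQ_zero' : QQ 0 = 0 := by simp [QQ]

lemma Wt_sq : ∀ (H : ℕ) (a : ℕ →₀ ℕ), a.support ⊆ range H → (Wt a:ℝ)^2 ≤ H * QQ a ∧ Wt a ≤ QQ a := by
  intro H
  induction H with
  | zero =>
    intro a ha
    have : a = 0 := by simpa using ha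
    subst this; simp [Wt_zero', QQ_zero']
  | succ H ih =>
    intro a ha
    obtain ⟨m, a', rfl⟩ := cons_surj a
    obtain ⟨h1, h2⟩ := ih a' (cons_supp_inv ha)
    rw [Wt_cons, QQ_cons]
    generalize m + A1 a' = N
    constructor
    · push_cast
      generalize (Wt a' : ℝ) = W at *
      have hQ : (0:ℝ) ≤ QQ a' := by positivity
      have hH : (0:ℝ) ≤ H := by positivity
      generalize (QQ a' : ℝ) = Q at *
      generalize (H : ℝ) = h at *
      generalize (N : ℝ) = n
      have : 2*n*W ≤ h*n^2 + Q := by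
        apply abs_le_of_sq_le_sq' _ (by positivity) |>.2
        nlinarith [sq_nonneg (h*n^2 - Q), mul_le_mul_of_nonneg_left h1 (sq_nonneg n)]
      nlinarith
    · nlinarith [Nat.le_mul_self N]

lemma PP_le (l : ℕ) (a : ℕ →₀ ℕ) : PP l a ≤ l * A1 a := by
  unfold PP A1
  rw [Finsupp.mul_sum]
  exact Finset.sum_le_sum fun i _ => Nat.mul_le_mul_right _ (min_le_right _ _)

lemma real_bound (n A M Q1 P Q2 k R r : ℝ) (hk : 18 ≤ k) (hM : 0 ≤ M) (hP : 0 ≤ P)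
    (h1 : M^2 ≤ k/2*Q1) (h2 : P^2 ≤ k/2*Q2) :
    (n - r - 2*(A+M-P))^2/(4*k) + R*(n - r - 2*(A+M-P))/(2*k) ≤
      3/4*((n/2-A)^2+Q1+Q2) + (3*r^2+2*R^2) := by
  have hk0 : 0 < k := by linarith
  have hQ1 : 0 ≤ Q1 := by nlinarith [sq_nonneg M]
  have hQ2 : 0 ≤ Q2 := by nlinarith [sq_nonneg P]
  set c := n/2 - A with hc
  set T := c - M + P with hT
  have hD : n - r - 2*(A+M-P) = 2*T - r := by rw [hT, hc]; ring
  rw [hD]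
  have hT2 : T^2 ≤ 9/8*(k/2)*(c^2+Q1+Q2) := by
    have : T^2 ≤ 9/8*(M-P)^2 + 9*c^2 := by
      rw [hT]; nlinarith [sq_nonneg (8*c + (M-P))]
    nlinarith [mul_nonneg hM hP, sq_nonneg c, mul_le_mul_of_nonneg_right hk (sq_nonneg c)]
  have hr : (T-r/2)^2 ≤ 9/8*T^2 + 9*r^2/4 := by nlinarith [sq_nonneg (T+4*r)]
  have hR : R*(T-r/2) ≤ (T-r/2)^2/8+2*R^2 := by nlinarith [sq_nonneg (T-r/2-4*R)]
  have e : (2*T-r)^2/(4*k) + R*(2*T-r)/(2*k) = ((T-r/2)^2 + R*(T-r/2))/k := by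
    field_simp; ring
  rw [e, div_le_iff₀ hk0]
  have hq : 0 ≤ c^2+Q1+Q2 := by positivity
  nlinarith [mul_nonneg hk0.le hq, mul_le_mul_of_nonneg_right hk (sq_nonneg r), mul_le_mul_of_nonneg_right hk (sq_nonneg R)]

def Ex (l n : ℕ) (a b : ℕ →₀ ℕ) : ℝ :=
  (n*(n+1)/2 : ℝ) - n * A1 a + QQ a - PP l a + QQ b

def Dz (r : ℤ) (n : ℕ) (a b : ℕ →₀ ℕ) : ℤ := (n:ℤ) - r - 2*((Wt a:ℤ) - Wt b)

lemma exp_bound (l : ℕ) (r : ℤ) (k n : ℕ) (hk : 18 ≤ k) (a b : ℕ →₀ ℕ)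
    (ha : a.support ⊆ range (k/2)) (hb : b.support ⊆ range (k-1-k/2)) :
    ((n + Wt a + Wt b : ℕ):ℝ)/16 - (3*(r:ℝ)^2 + 2*(r+l)^2 + 4*l^2) ≤
      Ex l n a b - (Dz r n a b:ℝ)^2/(4*k) - (r+l)*(Dz r n a b:ℝ)/(2*k) := by
  obtain ⟨b1, b2⟩ := Wt_sq _ b hb
  obtain ⟨-, a2⟩ := Wt_sq _ a ha
  have hPP := PP_le l a
  obtain ⟨m, a', rfl⟩ := cons_surj a
  have ha' : a'.support ⊆ range (k/2-1) := by
    apply cons_supp_inv (m := m)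
    rwa [show k/2-1+1 = k/2 by omega]
  obtain ⟨a1, -⟩ := Wt_sq _ a' ha'
  have hA := A1_cons m a'
  have hW := Wt_cons m a'
  have hQ := QQ_cons m a'
  rw [← hA] at hW hQ
  unfold Ex Dz
  have hkr : (18:ℝ) ≤ k := by exact_mod_cast hk
  have hc1 : ((k/2-1 : ℕ):ℝ) ≤ (k:ℝ)/2 := by
    rw [le_div_iff₀ (by norm_num)]; norm_cast; omega
  have hc2 : ((k-1-k/2 : ℕ):ℝ) ≤ (k:ℝ)/2 := by
    rw [le_div_iff₀ (by norm_num)]; norm_cast; omega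
  have hrb := real_bound n (A1 (consF m a')) (Wt a') (QQ a') (Wt b) (QQ b) k (r+l) r hkr (by positivity) (by positivity)
    (a1.trans (by gcongr)) (b1.trans (by gcongr))
  have a2' : (Wt (consF m a') : ℝ) ≤ QQ (consF m a') := by exact_mod_cast a2
  have b2' : (Wt b : ℝ) ≤ QQ b := by exact_mod_cast b2
  have hPP' : (PP l (consF m a') : ℝ) ≤ l * A1 (consF m a') := by exact_mod_cast hPP
  have hQ' : (QQ (consF m a') : ℝ) = (A1 (consF m a') : ℝ)^2 + QQ a' := by exact_mod_cast hQ
  have hW' : (Wt (consF m a') : ℝ) = A1 (consF m a') + Wt a' := by exact_mod_cast hW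
  push_cast
  rw [hW'] at a2' ⊢
  rw [hQ'] at a2' ⊢
  have p1 : (0:ℝ) ≤ QQ a' := by positivity
  have p2 : (0:ℝ) ≤ QQ b := by positivity
  have p3 : (0:ℝ) ≤ n := by positivity
  generalize (A1 (consF m a') : ℝ) = A at *
  generalize (Wt a' : ℝ) = M at *
  generalize (Wt b : ℝ) = P at *
  generalize (QQ a' : ℝ) = Q1 at *
  generalize (QQ b : ℝ) = Q2 at *
  generalize (PP l (consF m a') : ℝ) = L at *
  have s1 : A^2 ≤ 2*((n:ℝ)/2-A)^2 + n^2/2 := by nlinarith [sq_nonneg ((n:ℝ)-A)]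
  have s2 : (l:ℝ)*A ≤ A^2/16 + 4*l^2 := by nlinarith [sq_nonneg (A - 8*l)]
  nlinarith [sq_nonneg (n:ℝ)]

/- summability over finsupps -/
lemma finsupp_prod_le (H : ℕ) : ∀ (u : ℕ → ℕ → ℝ≥0∞),
    ∑' a : ℕ →₀ ℕ, (if a.support ⊆ range H then ∏ i ∈ range H, u i (a i) else 0) ≤
      ∏ i ∈ range H, ∑' m, u i m := by
  induction H with
  | zero =>
    intro u
    rw [tsum_eq_single 0]
    · simp
    · intro a ha
      rw [if_neg]; simpa using ha
  | succ H ih =>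
    intro u
    rw [← consE.tsum_eq, ENNReal.tsum_prod', Finset.prod_range_succ', mul_comm, ← ENNReal.tsum_mul_right]
    refine ENNReal.tsum_le_tsum fun m => ?_
    refine le_trans ?_ (mul_le_mul_right (ih (fun i => u (i+1))) (u 0 m))
    rw [← ENNReal.tsum_mul_left]
    refine ENNReal.tsum_le_tsum fun a => ?_
    change (if (consF m a).support ⊆ range (H+1) then ∏ i ∈ range (H+1), u i (consF m a i) else 0) ≤ _
    split_ifs with h1 h2
    · rw [Finset.prod_range_succ']
      simp only [consF_zero, consF_succ]
      rw [mul_comm]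
    · exact absurd (cons_supp_inv h1) h2
    · exact zero_le
    · exact zero_le

lemma one_var_bound {q : ℝ} (h0 : 0 < q) (h1 : q < 1) {x : ℝ} (hx0 : 0 < x) (hx1 : x < 1) (i : ℕ) :
    ∑' m : ℕ, ENNReal.ofReal (x^((i+1)*m) * (qP q q m)⁻¹) ≤
      ENNReal.ofReal (Real.exp ((qPInf q q)⁻¹ / (1-x) * x^(i+1))) := by
  have hi : ∀ n, 0 < (qP q q n)⁻¹ := fun n => inv_pos.2 (qq_pos h0 h1 n)
  set B := (qPInf q q)⁻¹ with hB
  have hBp : 0 < B := inv_pos.2 (qInf_pos h0 h1)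
  have hx2 : 0 < 1 - x := by linarith
  set y := x^(i+1) with hy
  have hy0 : 0 < y := by positivity
  have hyx : y ≤ x := by
    calc y ≤ x^1 := pow_le_pow_of_le_one hx0.le hx1.le (by omega)
      _ = x := pow_one x
  have hy1 : y < 1 := by linarith
  rw [tsum_eq_zero_add' ENNReal.summable]
  have : ∀ m : ℕ, ENNReal.ofReal (x^((i+1)*(m+1)) * (qP q q (m+1))⁻¹) ≤ ENNReal.ofReal (B*y*y^m) := by
    intro m
    apply ENNReal.ofReal_le_ofReal
    rw [pow_mul, ← hy, pow_succ]
    have := qq_inv_le h0 h1 (m+1)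
    have := hi (m+1)
    calc y^m*y*(qP q q (m+1))⁻¹ ≤ y^m*y*B := by gcongr
      _ = _ := by ring
  refine (add_le_add le_rfl (ENNReal.tsum_le_tsum this)).trans ?_
  rw [← ENNReal.ofReal_tsum_of_nonneg (fun m => by positivity)
    ((summable_geometric_of_lt_one hy0.le hy1).mul_left _), tsum_mul_left, tsum_geometric_of_lt_one hy0.le hy1]
  have hy2 : 0 < 1 - y := by linarith
  rw [← ENNReal.ofReal_add (by simp [qP_zero]) (by positivity)]
  apply ENNReal.ofReal_le_ofReal
  simp only [mul_zero, pow_zero, qP_zero, inv_one, mul_one]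
  rw [add_comm]
  refine le_trans ?_ (Real.add_one_le_exp _)
  have : (1-y)⁻¹ ≤ (1-x)⁻¹ := inv_anti₀ hx2 (by linarith)
  have : B*y*(1-y)⁻¹ ≤ B*y*(1-x)⁻¹ := by gcongr
  have e : B/(1-x)*y = B*y*(1-x)⁻¹ := by ring
  linarith

lemma wt_summable {q : ℝ} (h0 : 0 < q) (h1 : q < 1) {x : ℝ} (hx0 : 0 < x) (hx1 : x < 1) :
    Summable (fun a : ℕ →₀ ℕ => x^(Wt a) * wA q a) := by
  have hi : ∀ n, 0 < (qP q q n)⁻¹ := fun n => inv_pos.2 (qq_pos h0 h1 n)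
  set B := (qPInf q q)⁻¹ / (1-x) with hB
  have hBp : 0 < B := div_pos (inv_pos.2 (qInf_pos h0 h1)) (by linarith)
  have hnn : ∀ a : ℕ →₀ ℕ, 0 ≤ x^(Wt a) * wA q a := fun a => by
    have := wA_pos h0 h1 a; positivity
  have key : ∑' a : ℕ →₀ ℕ, ENNReal.ofReal (x^(Wt a) * wA q a) ≤
      ENNReal.ofReal (Real.exp (B * (1-x)⁻¹)) := by
    rw [ENNReal.tsum_eq_iSup_sum]
    refine iSup_le fun s => ?_
    have hH : ∃ H, ∀ a ∈ s, a.support ⊆ range H := by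
      choose f hf using exists_supp
      refine ⟨s.sup f, fun a ha => (hf a).trans (range_subset_range.2 (Finset.le_sup ha))⟩
    obtain ⟨H, hH⟩ := hH
    have h2 := finsupp_prod_le H (fun i m => ENNReal.ofReal (x^((i+1)*m) * (qP q q m)⁻¹))
    have h3 : ∑ a ∈ s, ENNReal.ofReal (x^(Wt a) * wA q a) ≤ ∑' a : ℕ →₀ ℕ,
        (if a.support ⊆ range H then ∏ i ∈ range H, ENNReal.ofReal (x^((i+1)*(a i)) * (qP q q (a i))⁻¹) else 0) := by
      refine le_trans (le_of_eq ?_) (ENNReal.sum_le_tsum s)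
      refine Finset.sum_congr rfl fun a ha => ?_
      rw [if_pos (hH a ha), ← ENNReal.ofReal_prod_of_nonneg, Finset.prod_mul_distrib, wA_range q (hH a ha),
        Wt_range (hH a ha), Finset.prod_pow_eq_pow_sum]
      intro i _
      have := hi (a i)
      positivity
    refine h3.trans (h2.trans ?_)
    refine (Finset.prod_le_prod' fun i _ => one_var_bound h0 h1 hx0 hx1 i).trans ?_
    rw [← ENNReal.ofReal_prod_of_nonneg (fun i _ => (Real.exp_pos _).le), ← Real.exp_sum]
    apply ENNReal.ofReal_le_ofReal
    apply Real.exp_le_exp.2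
    rw [← Finset.mul_sum, ← hB]
    have hg := summable_geometric_of_lt_one hx0.le hx1
    have : ∑ i ∈ range H, x^(i+1) ≤ ∑' i : ℕ, x^i := by
      refine le_trans (Finset.sum_le_sum (g := fun i => x^i) fun i _ => pow_le_pow_of_le_one hx0.le hx1.le (by omega)) (hg.sum_le_tsum _ (fun i _ => by positivity))
    rw [tsum_geometric_of_lt_one hx0.le hx1] at this
    gcongr
  have hne : ∑' a : ℕ →₀ ℕ, ENNReal.ofReal (x^(Wt a) * wA q a) ≠ ⊤ := ne_top_of_le_ne_top ENNReal.ofReal_ne_top key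
  have := ENNReal.summable_toReal hne
  refine this.congr fun a => ?_
  rw [ENNReal.toReal_ofReal (hnn a)]

end

noncomputable section
open Finset
open ENNReal

abbrev II3 := ℕ × (ℕ →₀ ℕ) × (ℕ →₀ ℕ)

def Fk (q : ℝ) (l : ℕ) (r : ℤ) (k : ℕ) (x : II3) : ℝ :=
  if x.2.1.support ⊆ range (k/2) ∧ x.2.2.support ⊆ range (k-1-k/2) ∧ (2*(k:ℤ)) ∣ Dz r x.1 x.2.1 x.2.2 then
    q^(Ex l x.1 x.2.1 x.2.2 - (Dz r x.1 x.2.1 x.2.2:ℝ)^2/(4*k) - (r+l)*(Dz r x.1 x.2.1 x.2.2:ℝ)/(2*k))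
      * ((qP q q x.1)⁻¹ * (wA q x.2.1 * wA q x.2.2))
  else 0

def Finf (q : ℝ) (l : ℕ) (r : ℤ) (x : II3) : ℝ :=
  if Dz r x.1 x.2.1 x.2.2 = 0 then
    q^(Ex l x.1 x.2.1 x.2.2) * ((qP q q x.1)⁻¹ * (wA q x.2.1 * wA q x.2.2))
  else 0

lemma Fk_lim (q : ℝ) (l : ℕ) (r : ℤ) (x : II3) :
    Filter.Tendsto (fun k => Fk q l r k x) Filter.atTop (nhds (Finf q l r x)) := by
  obtain ⟨n, a, b⟩ := x
  obtain ⟨H1, h1⟩ := exists_supp a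
  obtain ⟨H2, h2⟩ := exists_supp b
  apply tendsto_const_nhds.congr'
  filter_upwards [Filter.eventually_ge_atTop (2*H1+2*H2+2+(Dz r n a b).natAbs)] with k hk
  have s1 : a.support ⊆ range (k/2) := h1.trans (range_subset_range.2 (by omega))
  have s2 : b.support ⊆ range (k-1-k/2) := h2.trans (range_subset_range.2 (by omega))
  unfold Fk Finf
  dsimp only
  by_cases hD : Dz r n a b = 0
  · simp [hD, s1, s2]
  · rw [if_neg hD, if_neg]
    rintro ⟨-, -, h⟩
    exact hD (Int.eq_zero_of_abs_lt_dvd h (by rw [← Int.natCast_natAbs]; omega))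

lemma Fk_tendsto {q : ℝ} (h0 : 0 < q) (h1 : q < 1) (l : ℕ) (r : ℤ) :
    Filter.Tendsto (fun k => ∑' x, Fk q l r k x) Filter.atTop (nhds (∑' x, Finf q l r x)) := by
  have hi : ∀ n, 0 < (qP q q n)⁻¹ := fun n => inv_pos.2 (qq_pos h0 h1 n)
  have hw := wA_pos h0 h1
  set x := q^((1:ℝ)/16) with hx
  have hx0 : 0 < x := Real.rpow_pos_of_pos h0 _
  have hx1 : x < 1 := Real.rpow_lt_one h0.le h1 (by norm_num)
  set C : ℝ := 3*(r:ℝ)^2 + 2*(r+l)^2 + 4*l^2 with hC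
  have s1 : Summable (fun n : ℕ => x^n * (qP q q n)⁻¹) := by
    refine Summable.of_nonneg_of_le (fun n => ?_) (fun n => ?_)
      ((summable_geometric_of_lt_one hx0.le hx1).mul_right (qPInf q q)⁻¹)
    · have := hi n; positivity
    · have := qq_inv_le h0 h1 n; gcongr
  have s2 := wt_summable h0 h1 hx0 hx1
  have nn1 : ∀ n : ℕ, 0 ≤ x^n * (qP q q n)⁻¹ := fun n => by have := hi n; positivity
  have nn2 : ∀ a : ℕ →₀ ℕ, 0 ≤ x^(Wt a) * wA q a := fun a => by have := hw a; positivity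
  have s3 := s2.mul_of_nonneg s2 nn2 nn2
  have s4 := (s1.mul_of_nonneg s3 nn1 (fun p => mul_nonneg (nn2 _) (nn2 _))).mul_left (q^(-C))
  refine tendsto_tsum_of_dominated_convergence s4 (Fk_lim q l r) ?_
  filter_upwards [Filter.eventually_ge_atTop 18] with k hk
  rintro ⟨n, a, b⟩
  have := hi n; have := hw a; have := hw b
  dsimp only
  unfold Fk
  dsimp only
  split_ifs with h
  · obtain ⟨ha, hb, -⟩ := h
    rw [Real.norm_of_nonneg (by positivity)]
    have hE := exp_bound l r k n hk a b ha hb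
    rw [← hC] at hE
    have := Real.rpow_le_rpow_of_exponent_ge h0 h1.le hE
    have e : q ^ (((n + Wt a + Wt b : ℕ):ℝ)/16 - C) = q^(-C) * (x^n * (x^(Wt a) * x^(Wt b))) := by
      rw [hx, ← pow_add, ← pow_add, ← Real.rpow_natCast, ← Real.rpow_mul h0.le, ← Real.rpow_add h0]
      congr 1; push_cast; ring
    rw [e] at this
    calc _ ≤ q^(-C) * (x^n * (x^(Wt a) * x^(Wt b))) * ((qP q q n)⁻¹ * (wA q a * wA q b)) := by gcongr
      _ = _ := by ring
  · rw [norm_zero]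
    positivity

lemma Finf_eq {q : ℝ} (h0 : 0 < q) (h1 : q < 1) (l : ℕ) (r : ℤ) (n : ℕ) (a b : ℕ →₀ ℕ) :
    Finf q l r (n, a, b) = if (n:ℤ) - r = 2*((Wt a:ℤ) - Wt b) then
      en q n (A1 a) * (wL q l a * wL q 0 b) else 0 := by
  unfold Finf Dz
  dsimp only
  have e : ((n:ℤ) - r - 2*((Wt a:ℤ) - Wt b) = 0) ↔ ((n:ℤ) - r = 2*((Wt a:ℤ) - Wt b)) := sub_eq_zero
  simp only [e]
  split_ifs
  · have hP : PP 0 b = 0 := by simp [PP]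
    unfold en wL
    rw [hP]
    have : q^(Ex l n a b) = q^((n+1).choose 2) * (q^(n*A1 a))⁻¹ * (q^((QQ a : ℤ) - PP l a) * q^((QQ b : ℤ) - (0:ℕ))) := by
      rw [← Real.rpow_natCast, ← Real.rpow_natCast, ← Real.rpow_intCast, ← Real.rpow_intCast,
        ← Real.rpow_neg h0.le, ← Real.rpow_add h0, ← Real.rpow_add h0, ← Real.rpow_add h0]
      congr 1
      unfold Ex
      have h := choose2_dbl (n+1)
      have h' : 2 * (((n+1).choose 2 : ℕ) : ℝ) = (n+1) * n := by
        have := congrArg (fun z : ℤ => (z:ℝ)) h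
        push_cast at this
        rw [this]; ring
      push_cast
      linarith
    rw [this]; ring
  · rfl

lemma Finf_sum {q : ℝ} (h0 : 0 < q) (h1 : q < 1) (l : ℕ) (r : ℤ) :
    ∑' x, Finf q l r x = V q r - V q (r + 2*l + 1) := by
  have nn : ∀ x, 0 ≤ Finf q l r x := by
    rintro ⟨n, a, b⟩
    rw [Finf_eq h0 h1]
    split_ifs
    · exact mul_nonneg (en_nonneg h0 h1 _ _) (mul_nonneg (wL_nonneg h0 h1 _ _) (wL_nonneg h0 h1 _ _))
    · rfl
  rw [← LLE_eq h0 h1]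
  have : LLE q l r = ∑' x, ENNReal.ofReal (Finf q l r x) := by
    unfold LLE
    rw [ENNReal.tsum_prod']
    refine tsum_congr fun n => ?_
    rw [ENNReal.tsum_prod']
    refine tsum_congr fun a => tsum_congr fun b => ?_
    rw [Finf_eq h0 h1, ind]
    split_ifs
    · rw [one_mul, ENNReal.ofReal_mul (en_nonneg h0 h1 _ _), ENNReal.ofReal_mul (wL_nonneg h0 h1 _ _)]
    · simp
  rw [this, ENNReal.tsum_toReal_eq (fun _ => ENNReal.ofReal_ne_top)]
  exact tsum_congr fun x => (ENNReal.toReal_ofReal (nn x)).symm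

/- reindexing -/
def exv (k : ℕ) (v : Fin (k-1) → ℕ) (i : ℕ) : ℕ := if h : i < k-1 then v ⟨i, h⟩ else 0

def aOf (k : ℕ) (v : Fin (k-1) → ℕ) : ℕ →₀ ℕ :=
  Finsupp.onFinset (range (k/2)) (fun i => if i < k/2 then exv k v i else 0) (by
    intro i hi; by_contra h; simp at h; simp [h] at hi)

def bOf (k : ℕ) (v : Fin (k-1) → ℕ) : ℕ →₀ ℕ :=
  Finsupp.onFinset (range (k-1-k/2)) (fun i => if i < k-1-k/2 then exv k v (k-2-i) else 0) (by
    intro i hi; by_contra h; simp only [mem_range] at h; simp [h] at hi)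

lemma aOf_supp (k : ℕ) (v : Fin (k-1) → ℕ) : (aOf k v).support ⊆ range (k/2) := Finsupp.support_onFinset_subset
lemma bOf_supp (k : ℕ) (v : Fin (k-1) → ℕ) : (bOf k v).support ⊆ range (k-1-k/2) := Finsupp.support_onFinset_subset
lemma aOf_apply (k : ℕ) (v : Fin (k-1) → ℕ) {i : ℕ} (h : i < k/2) : aOf k v i = exv k v i := by
  simp [aOf, h]
lemma bOf_apply (k : ℕ) (v : Fin (k-1) → ℕ) {i : ℕ} (h : i < k-1-k/2) : bOf k v i = exv k v (k-2-i) := by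
  simp [bOf, h]

def phi (k : ℕ) (x : ℕ × (Fin (k-1) → ℕ)) : II3 := (x.1, aOf k x.2, bOf k x.2)

lemma phi_inj (k : ℕ) (hk : 2 ≤ k) : Function.Injective (phi k) := by
  rintro ⟨n, v⟩ ⟨n', v'⟩ h
  simp only [phi, Prod.mk.injEq] at h
  obtain ⟨rfl, ha, hb⟩ := h
  congr 1
  funext ⟨i, hi⟩
  have e : ∀ w : Fin (k-1) → ℕ, w ⟨i, hi⟩ = exv k w i := fun w => by simp [exv, hi]
  rw [e v, e v']
  by_cases h : i < k/2
  · rw [← aOf_apply k v h, ← aOf_apply k v' h, ha]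
  · have h1 : k-2-i < k-1-k/2 := by omega
    have h2 := bOf_apply k v h1
    have h3 := bOf_apply k v' h1
    rw [show k-2-(k-2-i) = i by omega] at h2 h3
    rw [← h2, ← h3, hb]

lemma phi_range (k : ℕ) (hk : 2 ≤ k) (n : ℕ) (a b : ℕ →₀ ℕ) (ha : a.support ⊆ range (k/2))
    (hb : b.support ⊆ range (k-1-k/2)) : (n, a, b) ∈ Set.range (phi k) := by
  set v : Fin (k-1) → ℕ := fun i => if (i:ℕ) < k/2 then a i else b (k-2-i) with hv
  refine ⟨(n, v), ?_⟩
  simp only [phi, Prod.mk.injEq, true_and]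
  constructor
  · ext i
    by_cases h : i < k/2
    · rw [aOf_apply _ _ h, exv, dif_pos (by omega)]; simp [hv, h]
    · have h1 : i ∉ (aOf k v).support := fun hh => h (by simpa using aOf_supp k v hh)
      have h2 : i ∉ a.support := fun hh => h (by simpa using ha hh)
      rw [Finsupp.notMem_support_iff.1 h1, Finsupp.notMem_support_iff.1 h2]
  · ext i
    by_cases h : i < k-1-k/2
    · rw [bOf_apply _ _ h, exv, dif_pos (by omega)]
      have e1 : ¬ (k-2-i < k/2) := by omega
      have e2 : k-2-(k-2-i) = i := by omega
      simp [hv, e1, e2]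
    · have h1 : i ∉ (bOf k v).support := fun hh => h (by simpa using bOf_supp k v hh)
      have h2 : i ∉ b.support := fun hh => h (by simpa using hb hh)
      rw [Finsupp.notMem_support_iff.1 h1, Finsupp.notMem_support_iff.1 h2]

lemma sum_split {M : Type*} [AddCommMonoid M] (k : ℕ) (hk : 2 ≤ k) (v : Fin (k-1) → ℕ) (f : ℕ → ℕ → M) :
    ∑ i : Fin (k-1), f i (v i) = ∑ i ∈ range (k/2), f i (aOf k v i) +
      ∑ i ∈ range (k-1-k/2), f (k-2-i) (bOf k v i) := by
  have e : ∑ i : Fin (k-1), f i (v i) = ∑ i ∈ range (k-1), f i (exv k v i) := by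
    rw [← Fin.sum_univ_eq_sum_range (fun i => f i (exv k v i))]
    exact Finset.sum_congr rfl fun i _ => by simp [exv]
  rw [e]
  have e2 : k - 1 = k/2 + (k-1-k/2) := by omega
  conv_lhs => rw [e2]
  rw [Finset.sum_range_add]
  congr 1
  · exact Finset.sum_congr rfl fun i hi => by rw [aOf_apply _ _ (by simpa using hi)]
  · rw [← Finset.sum_range_reflect]
    refine Finset.sum_congr rfl fun i hi => ?_
    have hi : i < k-1-k/2 := by simpa using hi
    rw [bOf_apply _ _ hi, show k/2 + (k-1-k/2-1-i) = k-2-i by omega]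

lemma prod_split (q : ℝ) (k : ℕ) (hk : 2 ≤ k) (v : Fin (k-1) → ℕ) :
    ∏ i : Fin (k-1), (qP q q (v i))⁻¹ = wA q (aOf k v) * wA q (bOf k v) := by
  rw [wA_range q (aOf_supp k v), wA_range q (bOf_supp k v)]
  exact sum_split (M := Additive ℝ) k hk v (fun _ m => Additive.ofMul (qP q q m)⁻¹)

lemma charge_split (k : ℕ) (hk : 2 ≤ k) (v : Fin (k-1) → ℕ) :
    ∑ i : Fin (k-1), ((i:ℤ)+1) * (v i:ℤ) = (Wt (aOf k v):ℤ) - Wt (bOf k v) + k * A1 (bOf k v) := by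
  rw [sum_split k hk v (fun i m => ((i:ℤ)+1)*(m:ℤ)), Wt_range (aOf_supp k v), Wt_range (bOf_supp k v), A1_range (bOf_supp k v)]
  push_cast
  rw [sub_add_eq_add_sub, add_sub_assoc, Finset.mul_sum, ← Finset.sum_sub_distrib]
  congr 1
  refine Finset.sum_congr rfl fun i hi => ?_
  have hi : i < k-1-k/2 := by simpa using hi
  have : ((k-2-i:ℕ):ℤ) = k-2-i := by omega
  rw [this]; ring

lemma cinv_aa (k i j : ℕ) : cinv k i j = ((min (i+1) (j+1) : ℕ) : ℚ) - ((i:ℚ)+1)*((j:ℚ)+1)/k := by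
  unfold cinv; push_cast; ring

lemma cinv_comm (k i j : ℕ) : cinv k i j = cinv k j i := by
  rw [cinv_aa, cinv_aa, min_comm]; ring

lemma cinv_ab {k i j : ℕ} (hk : 2 ≤ k) (hi : i < k/2) (hj : j < k-1-k/2) :
    cinv k i (k-2-j) = ((i:ℚ)+1)*((j:ℚ)+1)/k := by
  rw [cinv_aa, min_eq_left (by omega)]
  have : ((k-2-j:ℕ):ℚ) = k-2-j := by
    rw [Nat.cast_sub (by omega), Nat.cast_sub (by omega)]; norm_num
  have hk0 : (k:ℚ) ≠ 0 := by norm_cast; omega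
  rw [this]; push_cast; field_simp; ring

lemma cinv_bb {k i j : ℕ} (hk : 2 ≤ k) (hi : i < k-1-k/2) (hj : j < k-1-k/2) :
    cinv k (k-2-i) (k-2-j) = ((min (i+1) (j+1) : ℕ) : ℚ) - ((i:ℚ)+1)*((j:ℚ)+1)/k := by
  rw [cinv_aa]
  have c : ∀ j, j < k-1-k/2 → ((k-2-j:ℕ):ℚ) = k-2-j := by
    intro j hj
    rw [Nat.cast_sub (by omega), Nat.cast_sub (by omega)]; norm_num
  have hk0 : (k:ℚ) ≠ 0 := by norm_cast; omega
  rw [c i hi, c j hj]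
  rcases le_total i j with h | h
  · rw [min_eq_left (show i+1 ≤ j+1 by omega), min_eq_right (show k-2-j+1 ≤ k-2-i+1 by omega)]
    push_cast; rw [c j hj]; field_simp; ring
  · rw [min_eq_right (show j+1 ≤ i+1 by omega), min_eq_left (show k-2-i+1 ≤ k-2-j+1 by omega)]
    push_cast; rw [c i hi]; field_simp; ring

lemma quad_self (k : ℕ) (hk : 2 ≤ k) (v : Fin (k-1) → ℕ) :
    quad k (fun i => (v i:ℤ)) (fun i => (v i:ℤ)) =
      (QQ (aOf k v):ℚ) + QQ (bOf k v) - ((Wt (aOf k v):ℚ) - Wt (bOf k v))^2/k := by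
  unfold quad
  rw [sum_split k hk v (fun i m => ∑ j : Fin (k-1), (((m:ℕ):ℤ):ℚ) * cinv k i j * (((v j:ℕ):ℤ):ℚ))]
  have e : ∀ (i m : ℕ), ∑ j : Fin (k-1), ((m:ℤ):ℚ) * cinv k i j * ((v j:ℤ):ℚ) =
    ∑ j ∈ range (k/2), (m:ℚ) * cinv k i j * (aOf k v j:ℚ) + ∑ j ∈ range (k-1-k/2), (m:ℚ) * cinv k i (k-2-j) * (bOf k v j:ℚ) := by
    intro i m
    rw [sum_split k hk v (fun j m' => ((m:ℤ):ℚ) * cinv k i j * ((m':ℤ):ℚ))]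
    simp
  simp only [e, sum_add_distrib]
  have haa : ∑ i ∈ range (k/2), ∑ j ∈ range (k/2), (aOf k v i:ℚ) * cinv k i j * (aOf k v j:ℚ)
      = (QQ (aOf k v):ℚ) - (Wt (aOf k v):ℚ)^2/k := by
    rw [QQ_range (aOf_supp k v), Wt_range (aOf_supp k v)]
    push_cast
    rw [sq, Finset.sum_mul_sum, Finset.sum_div, ← Finset.sum_sub_distrib]
    refine Finset.sum_congr rfl fun i _ => ?_
    rw [Finset.sum_div, ← Finset.sum_sub_distrib]
    refine Finset.sum_congr rfl fun j _ => ?_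
    rw [cinv_aa]; push_cast; ring
  have hbb : ∑ i ∈ range (k-1-k/2), ∑ j ∈ range (k-1-k/2), (bOf k v i:ℚ) * cinv k (k-2-i) (k-2-j) * (bOf k v j:ℚ)
      = (QQ (bOf k v):ℚ) - (Wt (bOf k v):ℚ)^2/k := by
    rw [QQ_range (bOf_supp k v), Wt_range (bOf_supp k v)]
    push_cast
    rw [sq, Finset.sum_mul_sum, Finset.sum_div, ← Finset.sum_sub_distrib]
    refine Finset.sum_congr rfl fun i hi => ?_
    rw [Finset.sum_div, ← Finset.sum_sub_distrib]
    refine Finset.sum_congr rfl fun j hj => ?_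
    rw [cinv_bb hk (by simpa using hi) (by simpa using hj)]; push_cast; ring
  have hab : ∑ i ∈ range (k/2), ∑ j ∈ range (k-1-k/2), (aOf k v i:ℚ) * cinv k i (k-2-j) * (bOf k v j:ℚ)
      = (Wt (aOf k v):ℚ) * (Wt (bOf k v):ℚ)/k := by
    rw [Wt_range (aOf_supp k v), Wt_range (bOf_supp k v)]
    push_cast
    rw [Finset.sum_mul_sum, Finset.sum_div]
    refine Finset.sum_congr rfl fun i hi => ?_
    rw [Finset.sum_div]
    refine Finset.sum_congr rfl fun j hj => ?_
    rw [cinv_ab hk (by simpa using hi) (by simpa using hj)]; ring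
  have hba : ∑ i ∈ range (k-1-k/2), ∑ j ∈ range (k/2), (bOf k v i:ℚ) * cinv k (k-2-i) j * (aOf k v j:ℚ)
      = (Wt (aOf k v):ℚ) * (Wt (bOf k v):ℚ)/k := by
    rw [← hab, Finset.sum_comm]
    refine Finset.sum_congr rfl fun i _ => Finset.sum_congr rfl fun j _ => ?_
    rw [cinv_comm]; ring
  rw [haa, hbb, hab, hba]
  ring

lemma quad_e (k l : ℕ) (hk : 2 ≤ k) (hl : 1 ≤ l) (hlk : l ≤ k/2) (v : Fin (k-1) → ℕ) :
    quad k (fun i => (v i:ℤ)) (eV k l) =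
      (PP l (aOf k v):ℚ) - l*((Wt (aOf k v):ℚ) - Wt (bOf k v))/k := by
  unfold quad eV
  have e : ∀ i : Fin (k-1), ∑ j : Fin (k-1), ((v i:ℤ):ℚ) * cinv k i j * ((if (j:ℤ)+1 = (l:ℤ) then 1 else 0 : ℤ):ℚ)
      = (v i:ℚ) * cinv k i (l-1) := by
    intro i
    rw [Finset.sum_eq_single (⟨l-1, by omega⟩ : Fin (k-1))]
    · rw [if_pos (by simp; omega)]; simp
    · intro j _ hj
      rw [if_neg]
      · simp
      · intro h; apply hj; ext; simp; omega
    · simp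
  simp only [e]
  rw [sum_split k hk v (fun i m => (m:ℚ) * cinv k i (l-1)), PP_range l (aOf_supp k v), Wt_range (aOf_supp k v), Wt_range (bOf_supp k v)]
  have hl' : ((l-1:ℕ):ℚ) = l-1 := by rw [Nat.cast_sub hl]; norm_num
  have ha : ∑ i ∈ range (k/2), (aOf k v i:ℚ) * cinv k i (l-1) =
      ((∑ i ∈ range (k/2), min (i+1) l * aOf k v i : ℕ):ℚ) - l*((∑ i ∈ range (k/2), (i+1) * aOf k v i : ℕ):ℚ)/k := by
    push_cast
    rw [Finset.mul_sum, Finset.sum_div, ← Finset.sum_sub_distrib]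
    refine Finset.sum_congr rfl fun i _ => ?_
    rw [cinv_aa, show l-1+1 = l by omega, hl']; push_cast; ring
  have hb : ∑ i ∈ range (k-1-k/2), (bOf k v i:ℚ) * cinv k (k-2-i) (l-1) =
      l*((∑ i ∈ range (k-1-k/2), (i+1) * bOf k v i : ℕ):ℚ)/k := by
    push_cast
    rw [Finset.mul_sum, Finset.sum_div]
    refine Finset.sum_congr rfl fun i hi => ?_
    rw [cinv_comm, cinv_ab hk (by omega) (by simpa using hi), hl']; ring
  rw [ha, hb]; ring

lemma quad_lin (k : ℕ) (w v e f : Fin (k-1) → ℤ) (n : ℤ) :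
    quad k w (v - n • e - f) = quad k w v - n * quad k w e - quad k w f := by
  unfold quad
  rw [Finset.mul_sum, ← Finset.sum_sub_distrib, ← Finset.sum_sub_distrib]
  refine Finset.sum_congr rfl fun i _ => ?_
  rw [Finset.mul_sum, ← Finset.sum_sub_distrib, ← Finset.sum_sub_distrib]
  refine Finset.sum_congr rfl fun j _ => ?_
  simp only [Pi.sub_apply, Pi.smul_apply, smul_eq_mul]
  push_cast; ring

lemma PP_one (a : ℕ →₀ ℕ) : PP 1 a = A1 a := by
  unfold PP A1; exact Finset.sum_congr rfl fun i _ => by simp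

lemma term_eq (q : ℝ) (l : ℕ) (hl : 1 ≤ l) (r : ℤ) (k : ℕ) (hk : 2*l+2 ≤ k) (x : ℕ × (Fin (k-1) → ℕ)) :
    (if (2 * (k : ℤ)) ∣ ((x.1 : ℤ) - r - 2 * ∑ i : Fin (k - 1), ((i : ℤ) + 1) * (x.2 i : ℤ))
        then
          q ^ ( (((r - (x.1 : ℤ)) * (r + (x.1 : ℤ) + 2 * (l:ℤ)) : ℤ) : ℝ) / (4 * (k : ℝ))
              + ((ch2 ((x.1 : ℤ) + 1) : ℤ) : ℝ)
              + ((quad k (fun i => (x.2 i : ℤ))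
                  ((fun i => (x.2 i : ℤ)) - (x.1 : ℤ) • eV k 1 - eV k (l:ℤ)) : ℚ) : ℝ) )
            * ((qP q q x.1)⁻¹ * ∏ i : Fin (k - 1), (qP q q (x.2 i))⁻¹)
        else 0) = Fk q l r k (phi k x) := by
  obtain ⟨n, v⟩ := x
  unfold Fk phi
  dsimp only
  have hk2 : 2 ≤ k := by omega
  rw [charge_split k hk2, prod_split q k hk2]
  have hc : ((2 * (k : ℤ)) ∣ ((n : ℤ) - r - 2 * ((Wt (aOf k v):ℤ) - Wt (bOf k v) + k * A1 (bOf k v))))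
     ↔ (2*(k:ℤ)) ∣ Dz r n (aOf k v) (bOf k v) := by
    rw [show (n : ℤ) - r - 2 * ((Wt (aOf k v):ℤ) - Wt (bOf k v) + k * A1 (bOf k v)) =
      Dz r n (aOf k v) (bOf k v) - 2*(k:ℤ) * A1 (bOf k v) by unfold Dz; ring]
    exact dvd_sub_left (dvd_mul_right _ _)
  simp only [hc, aOf_supp, bOf_supp, true_and]
  split_ifs
  · congr 2
    have h1 := quad_e k 1 hk2 le_rfl (by omega) v
    rw [Nat.cast_one] at h1
    rw [quad_lin, quad_self k hk2, h1, quad_e k l hk2 hl (by omega), PP_one]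
    have hd : (ch2 ((n:ℤ)+1):ℝ) = n*(n+1)/2 := by
      have := congrArg (fun z : ℤ => (z:ℝ)) (ch2_dbl ((n:ℤ)+1))
      push_cast at this
      linarith
    rw [hd]
    unfold Ex Dz
    have hk0 : (k:ℝ) ≠ 0 := by norm_cast; omega
    push_cast
    field_simp
    ring
  · rfl

lemma S_eq (q : ℝ) (l : ℕ) (r : ℤ) (k : ℕ) (hk : 2*l+2 ≤ k) :
    ∑' x, Fk q l r k (phi k x) = ∑' x, Fk q l r k x := by
  refine (phi_inj k (by omega)).tsum_eq ?_
  rintro ⟨n, a, b⟩ hx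
  rw [Function.mem_support] at hx
  unfold Fk at hx
  dsimp only at hx
  split_ifs at hx with h
  · exact phi_range k (by omega) n a b h.1 h.2.1
  · exact absurd rfl hx

end

/-- The large-`k` limit of the fermionic graded parafermion character equals
the bosonic form `V_r - V_{r+2ℓ+1}`. -/
theorem fermionic_large_k_limit
    (ℓ : ℤ) (hℓ : 1 ≤ ℓ) (r : ℤ) (q : ℝ) (hq0 : 0 < q) (hq1 : q < 1)
    (S : ℕ → ℝ)
    (hS : ∀ k : ℕ, max ℓ 1 ≤ (k : ℤ) →
      S k = ∑' x : ℕ × (Fin (k - 1) → ℕ),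
        (if (2 * (k : ℤ)) ∣ ((x.1 : ℤ) - r - 2 * ∑ i : Fin (k - 1), ((i : ℤ) + 1) * (x.2 i : ℤ))
        then
          q ^ ( (((r - (x.1 : ℤ)) * (r + (x.1 : ℤ) + 2 * ℓ) : ℤ) : ℝ) / (4 * (k : ℝ))
              + ((ch2 ((x.1 : ℤ) + 1) : ℤ) : ℝ)
              + ((quad k (fun i => (x.2 i : ℤ))
                  ((fun i => (x.2 i : ℤ)) - (x.1 : ℤ) • eV k 1 - eV k ℓ) : ℚ) : ℝ) )
            * ((qP q q x.1)⁻¹ * ∏ i : Fin (k - 1), (qP q q (x.2 i))⁻¹)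
        else 0)) :
    Filter.Tendsto S Filter.atTop (nhds (V q r - V q (r + 2 * ℓ + 1))) := by
  lift ℓ to ℕ using (by omega) with l
  have hl : 1 ≤ l := by exact_mod_cast hℓ
  have hlim := Fk_tendsto hq0 hq1 l r
  rw [Finf_sum hq0 hq1] at hlim
  refine hlim.congr' ?_
  filter_upwards [Filter.eventually_ge_atTop (2*l+2)] with k hk
  rw [hS k (by omega), ← S_eq q l r k hk]
  exact tsum_congr fun x => (term_eq q l hl r k hk x).symm
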